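/- arXiv:2006.04235 — 9 statements merged into one kernel-verified Lean document; each statement's English description precedes it below -/
import Mathlib

section
/- For every j ≥ 1 and k, k' ∈ {1,…,2^j} with k ≠ k', there exists a constant c_{k,k'} ∈ (0,1) such that |Q_{j,k,k'}| ≤ (15/(8√π)) · 2^{j/2} / (2|k−k'| − 2 + c_{k,k'})^{7/2}. -/
open MeasureTheory Real Finset

/-- Covariance of the mild solution of the stochastic heat equation at a fixed spatial point. -/
noncomputable def R (t s : ℝ) : ℝ :=
  (1 / Real.sqrt (2 * Real.pi)) * (Real.sqrt (t + s) - Real.sqrt |t - s|)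

/-- Dyadic points: `a j k 0 = (2k−1)/2^{j+1}`, `a j k 1 = 2k/2^{j+1}`, `a j k 2 = (2k−2)/2^{j+1}`. -/
noncomputable def a (j k : ℕ) (m : ℕ) : ℝ :=
  (2 * (k : ℝ) - (if m = 0 then 1 else if m = 1 then 0 else 2)) / 2 ^ (j + 1)

/-- Weights `c 0 = 1`, `c 1 = c 2 = −1/2`. -/
noncomputable def c (m : ℕ) : ℝ := if m = 0 then 1 else -(1 / 2)

/-- `Q j k k' = E[u_{jk} u_{jk'}]` for the Schauder coefficients of the solution in time. -/
noncomputable def Q (j k k' : ℕ) : ℝ :=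
  4 * 2 ^ j * ∑ m ∈ Finset.range 3, ∑ m' ∈ Finset.range 3,
    c m * c m' * R (a j k m) (a j k' m')

/-- One-step progressive difference of order 4 at 0. -/
noncomputable def Δ4 (f : ℝ → ℝ) : ℝ :=
  ∑ i ∈ Finset.range 5, (-1 : ℝ) ^ (4 - i) * (Nat.choose 4 i : ℝ) * f i

/-- The fourth central difference of the square root. -/
noncomputable def sqrtDiff4 (x : ℝ) : ℝ :=
  √(x - 2) - 4 * √(x - 1) + 6 * √x - 4 * √(x + 1) + √(x + 2)

/-- The third order Taylor polynomial of `√(1 + u)` at `u = 0`. -/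
noncomputable def sqrtTaylor (u : ℝ) : ℝ := 1 + u / 2 - u ^ 2 / 8 + u ^ 3 / 16

lemma sqrtTaylor_sub_sqrt_mul {u : ℝ} (hu : |u| ≤ 1) :
    (sqrtTaylor u - √(1 + u)) * (sqrtTaylor u + √(1 + u)) =
      u ^ 4 * (5 / 64 - u / 64 + u ^ 2 / 256) := by
  have h := Real.sq_sqrt (show 0 ≤ 1 + u by linarith [(abs_le.1 hu).1])
  unfold sqrtTaylor
  linear_combination -h

/-- The remainder is controlled by a lower bound `s` for `sqrtTaylor u + √(1 + u)`. -/
lemma sqrtTaylor_sub_sqrt_mem {u s K : ℝ} (hu : |u| ≤ 1) (hs : 0 < s)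
    (hsum : s ≤ sqrtTaylor u + √(1 + u)) (hK : 5 / 64 - u / 64 + u ^ 2 / 256 ≤ K * s) :
    0 ≤ sqrtTaylor u - √(1 + u) ∧ sqrtTaylor u - √(1 + u) ≤ K * u ^ 4 := by
  have h := sqrtTaylor_sub_sqrt_mul hu
  obtain ⟨h1, h2⟩ := abs_le.1 hu
  have hq : 0 ≤ 5 / 64 - u / 64 + u ^ 2 / 256 := by nlinarith [sq_nonneg u]
  have hpos : 0 < sqrtTaylor u + √(1 + u) := hs.trans_le hsum
  have h0 : 0 ≤ sqrtTaylor u - √(1 + u) :=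
    nonneg_of_mul_nonneg_left (h ▸ by positivity) hpos
  refine ⟨h0, le_of_mul_le_mul_right ?_ hs⟩
  calc (sqrtTaylor u - √(1 + u)) * s
      ≤ (sqrtTaylor u - √(1 + u)) * (sqrtTaylor u + √(1 + u)) := by gcongr
    _ = u ^ 4 * (5 / 64 - u / 64 + u ^ 2 / 256) := h
    _ ≤ u ^ 4 * (K * s) := by gcongr
    _ = K * u ^ 4 * s := by ring

lemma sqrtTaylor_sub_sqrt_mem_of_abs_le_one {u : ℝ} (hu : |u| ≤ 1) :
    0 ≤ sqrtTaylor u - √(1 + u) ∧ sqrtTaylor u - √(1 + u) ≤ 5 / 16 * u ^ 4 := by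
  obtain ⟨h1, h2⟩ := abs_le.1 hu
  refine sqrtTaylor_sub_sqrt_mem hu (s := 5 / 16) (by norm_num) ?_ (by nlinarith)
  have := Real.sqrt_nonneg (1 + u)
  unfold sqrtTaylor
  nlinarith [mul_nonneg (show 0 ≤ 1 + u by linarith) (sq_nonneg (u - 3 / 2))]

lemma sqrtTaylor_sub_sqrt_mem_of_abs_le_half {u : ℝ} (hu : |u| ≤ 1 / 2) :
    0 ≤ sqrtTaylor u - √(1 + u) ∧ sqrtTaylor u - √(1 + u) ≤ 3 / 32 * u ^ 4 := by
  obtain ⟨h1, h2⟩ := abs_le.1 hu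
  refine sqrtTaylor_sub_sqrt_mem (hu.trans (by norm_num)) (s := 1) one_pos ?_ (by nlinarith)
  have h3 : 1 / 2 ≤ √(1 + u) := Real.le_sqrt_of_sq_le (by linarith)
  have h4 : 1 / 2 ≤ sqrtTaylor u := by
    unfold sqrtTaylor
    nlinarith [mul_nonneg (show 0 ≤ 1 / 2 + u by linarith) (sq_nonneg (u - 5 / 4))]
  linarith

lemma sqrtDiff4_mem {x K : ℝ} (hx : 2 ≤ x)
    (hK : ∀ u : ℝ, |u| ≤ 2 / x →
      0 ≤ sqrtTaylor u - √(1 + u) ∧ sqrtTaylor u - √(1 + u) ≤ K * u ^ 4) :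
    -(32 * K / x ^ (7 / 2 : ℝ)) ≤ sqrtDiff4 x ∧ sqrtDiff4 x ≤ 8 * K / x ^ (7 / 2 : ℝ) := by
  have hx0 : 0 < x := by linarith
  have hpow : x ^ (7 / 2 : ℝ) * √x = x ^ 4 := by
    rw [Real.sqrt_eq_rpow, ← Real.rpow_add hx0, ← Real.rpow_natCast]
    norm_num
  have hs : 0 < √x := Real.sqrt_pos.2 hx0
  have hinv : ∀ b : ℝ, b / x ^ (7 / 2 : ℝ) = √x * (b * (1 / x) ^ 4) := by
    intro b
    have : 0 < x ^ (7 / 2 : ℝ) := by positivity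
    rw [div_pow, one_pow, ← hpow]
    field_simp
  have hsq : ∀ e : ℝ, √(x + e) = √x * √(1 + e * (1 / x)) := by
    intro e
    rw [← Real.sqrt_mul hx0.le]
    congr 1
    field_simp
  have hr : ∀ e : ℝ, |e| ≤ 2 →
      0 ≤ sqrtTaylor (e * (1 / x)) - √(1 + e * (1 / x)) ∧
      sqrtTaylor (e * (1 / x)) - √(1 + e * (1 / x)) ≤ K * (e * (1 / x)) ^ 4 := by
    intro e he
    apply hK
    rw [abs_mul, abs_of_pos (show 0 < 1 / x by positivity), mul_one_div]
    gcongr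
  have hD : sqrtDiff4 x = √x * (√(1 + (-2) * (1 / x)) - 4 * √(1 + (-1) * (1 / x)) + 6
      - 4 * √(1 + 1 * (1 / x)) + √(1 + 2 * (1 / x))) := by
    rw [sqrtDiff4, sub_eq_add_neg x 2, sub_eq_add_neg x 1, hsq, hsq (-1), hsq 1, hsq 2]
    ring
  obtain ⟨a1, a2⟩ := hr (-2) (by norm_num)
  obtain ⟨b1, b2⟩ := hr (-1) (by norm_num)
  obtain ⟨c1, c2⟩ := hr 1 (by norm_num)
  obtain ⟨d1, d2⟩ := hr 2 (by norm_num)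
  rw [hD, hinv, hinv, ← mul_neg]
  generalize 1 / x = y at *
  simp only [sqrtTaylor] at *
  constructor <;> refine mul_le_mul_of_nonneg_left ?_ hs.le <;> linarith

lemma abs_sqrtDiff4_sub_le {m n K : ℝ} (hm : 2 ≤ m) (hmn : m ≤ n) (hK0 : 0 ≤ K)
    (hK : ∀ u : ℝ, |u| ≤ 2 / m →
      0 ≤ sqrtTaylor u - √(1 + u) ∧ sqrtTaylor u - √(1 + u) ≤ K * u ^ 4) :
    |sqrtDiff4 n - sqrtDiff4 m| ≤ 40 * K / m ^ (7 / 2 : ℝ) := by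
  have hm0 : 0 < m := by linarith
  obtain ⟨a1, a2⟩ := sqrtDiff4_mem hm hK
  obtain ⟨b1, b2⟩ := sqrtDiff4_mem (hm.trans hmn) fun u hu =>
    hK u (hu.trans (by gcongr))
  have h1 : 32 * K / n ^ (7 / 2 : ℝ) ≤ 32 * K / m ^ (7 / 2 : ℝ) := by gcongr
  have h2 : 8 * K / n ^ (7 / 2 : ℝ) ≤ 8 * K / m ^ (7 / 2 : ℝ) := by gcongr
  have h3 : 40 * K / m ^ (7 / 2 : ℝ) = 32 * K / m ^ (7 / 2 : ℝ) + 8 * K / m ^ (7 / 2 : ℝ) := by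
    ring
  rw [abs_le]
  constructor <;> linarith

lemma abs_sqrtDiff4_sub_le_of_even {d n : ℝ} (hd : d = 1 ∨ 2 ≤ d) (hn : 2 * d ≤ n) :
    |sqrtDiff4 n - sqrtDiff4 (2 * d)| ≤ 15 / 4 / (2 * d - 2 + 1 / 4) ^ (7 / 2 : ℝ) := by
  rcases hd with rfl | hd
  · refine (abs_sqrtDiff4_sub_le (by norm_num) hn (K := 5 / 16) (by norm_num) fun u hu =>
      sqrtTaylor_sub_sqrt_mem_of_abs_le_one (hu.trans (by norm_num))).trans ?_
    have h1 : (1 : ℝ) ≤ (2 * 1) ^ (7 / 2 : ℝ) :=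
      Real.one_le_rpow (by norm_num) (by norm_num)
    have h2 : (2 * 1 - 2 + 1 / 4 : ℝ) ^ (7 / 2 : ℝ) ≤ 1 / 4 := by
      have := Real.rpow_le_rpow_of_exponent_ge (x := 1 / 4) (by norm_num) (by norm_num)
        (show (1 : ℝ) ≤ 7 / 2 by norm_num)
      norm_num at this ⊢
    calc 40 * (5 / 16) / (2 * 1 : ℝ) ^ (7 / 2 : ℝ) ≤ 40 * (5 / 16) / 1 := by gcongr
      _ ≤ 15 / 4 / (1 / 4) := by norm_num
      _ ≤ _ := by gcongr
  · refine (abs_sqrtDiff4_sub_le (by linarith) hn (K := 3 / 32) (by norm_num) fun u hu =>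
      sqrtTaylor_sub_sqrt_mem_of_abs_le_half (hu.trans ?_)).trans ?_
    · rw [div_le_div_iff₀ (by linarith) (by norm_num)]
      linarith
    · rw [show (40 * (3 / 32) : ℝ) = 15 / 4 by norm_num]
      have : 0 < 2 * d - 2 + 1 / 4 := by linarith
      gcongr
      linarith

lemma R_comm (t s : ℝ) : R t s = R s t := by
  rw [R, R, add_comm, abs_sub_comm]

lemma Q_comm (j k k' : ℕ) : Q j k k' = Q j k' k := by
  rw [Q, Q, Finset.sum_comm]
  congr 1
  refine Finset.sum_congr rfl fun m _ => Finset.sum_congr rfl fun m' _ => ?_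
  rw [R_comm, mul_comm (c m)]

lemma R_div {H x y : ℝ} (hH : 0 < H) (hxy : y ≤ x) :
    R (x / H) (y / H) = 1 / √(2 * π) * (√(x + y) - √(x - y)) / √H := by
  rw [R, ← add_div, ← sub_div, abs_of_nonneg (div_nonneg (sub_nonneg.2 hxy) hH.le),
    Real.sqrt_div' _ hH.le, Real.sqrt_div' _ hH.le]
  ring

lemma Q_eq_sqrtDiff4 (j : ℕ) {k k' : ℕ} (h : k' < k) :
    Q j k k' = √(2 ^ j) / (2 * √π) *
      (sqrtDiff4 (2 * k + 2 * k' - 2) - sqrtDiff4 (2 * (k - k'))) := by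
  have hk : (k' : ℝ) + 1 ≤ k := by exact_mod_cast h
  have hH : (0 : ℝ) < 2 ^ (j + 1) := by positivity
  have hc : (2 : ℝ) ^ j * (1 / √(2 * π) / √(2 ^ (j + 1))) = √(2 ^ j) / (2 * √π) := by
    have h2 : √(2 : ℝ) * √2 = 2 := Real.mul_self_sqrt (by norm_num)
    have hj : √((2 : ℝ) ^ j) * √(2 ^ j) = 2 ^ j := Real.mul_self_sqrt (by positivity)
    have hpi : 0 < √π := Real.sqrt_pos.2 Real.pi_pos
    rw [pow_succ, Real.sqrt_mul (by norm_num), Real.sqrt_mul (by positivity)]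
    have : 0 < √((2 : ℝ) ^ j) := by positivity
    field_simp
    rw [sq, sq, h2, hj]
    ring
  rw [← hc]
  simp only [Q, a, c, Finset.sum_range_succ, Finset.sum_range_zero, if_true, if_false,
    one_ne_zero, OfNat.ofNat_ne_zero, OfNat.ofNat_ne_one, zero_add]
  repeat rw [R_div hH (by linarith)]
  unfold sqrtDiff4
  ring_nf

theorem stmt_3 (j k k' : ℕ) (hj : 1 ≤ j)
    (hk : k ∈ Finset.Icc 1 (2 ^ j)) (hk' : k' ∈ Finset.Icc 1 (2 ^ j)) (hne : k ≠ k') :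
    ∃ ckk' ∈ Set.Ioo (0 : ℝ) 1,
      |Q j k k'| ≤ (15 / (8 * Real.sqrt Real.pi)) *
        (2 : ℝ) ^ ((j : ℝ) / 2) / (2 * |(k : ℝ) - (k' : ℝ)| - 2 + ckk') ^ ((7 : ℝ) / 2) := by
  wlog h : k' < k generalizing k k'
  · rw [Q_comm, abs_sub_comm (k : ℝ)]
    exact this k' k hk' hk hne.symm (lt_of_le_of_ne (not_lt.1 h) hne)
  refine ⟨1 / 4, by norm_num, ?_⟩
  have hk_one : (1 : ℝ) ≤ k' := by exact_mod_cast (Finset.mem_Icc.1 hk').1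
  have hkk : (k' : ℝ) < k := by exact_mod_cast h
  have hd : (k : ℝ) - k' = 1 ∨ 2 ≤ (k : ℝ) - k' := by
    rcases (Nat.succ_le_of_lt h).eq_or_lt with h1 | h1
    · left
      rw [← h1]
      push_cast
      ring
    · right
      have : (k' : ℝ) + 2 ≤ k := by exact_mod_cast h1
      linarith
  have hpow : (2 : ℝ) ^ ((j : ℝ) / 2) = √(2 ^ j) := by
    rw [Real.sqrt_eq_rpow, ← Real.rpow_natCast, ← Real.rpow_mul (by norm_num)]
    ring_nf
  rw [Q_eq_sqrtDiff4 j h, abs_mul, abs_of_nonneg (show 0 ≤ √(2 ^ j) / (2 * √π) by positivity),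
    abs_of_pos (sub_pos.2 hkk), hpow]
  calc _ ≤ √(2 ^ j) / (2 * √π) * (15 / 4 / (2 * ((k : ℝ) - k') - 2 + 1 / 4) ^ (7 / 2 : ℝ)) := by
        gcongr
        exact abs_sqrtDiff4_sub_le_of_even hd (by linarith)
    _ = _ := by ring
end

section
/- There exists a constant m > 0 such that for every j ≥ 1 and every k ∈ {1,…,2^j}, m · 2^{j/2} ≤ Q_{j,k,k} ≤ ((4 − √2)/√π) · 2^{j/2}. -/
open MeasureTheory Real Finset

/-- The fourth central difference of the square root is nonpositive. -/
lemma sqrt_fourth_difference_nonpos {x : ℝ} (hx : 2 ≤ x) :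
    6 * √x + √(x + 2) + √(x - 2) ≤ 4 * (√(x + 1) + √(x - 1)) := by
  have hy := Real.sq_sqrt (show 0 ≤ x by linarith)
  have hp := Real.sq_sqrt (show 0 ≤ x + 1 by linarith)
  have hq := Real.sq_sqrt (show 0 ≤ x - 1 by linarith)
  have hr := Real.sq_sqrt (show 0 ≤ x + 2 by linarith)
  have ht := Real.sq_sqrt (show 0 ≤ x - 2 by linarith)
  have hp0 := Real.sqrt_nonneg (x + 1)
  have hq0 := Real.sqrt_nonneg (x - 1)
  set y := √x
  set p := √(x + 1)
  set q := √(x - 1)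
  set r := √(x + 2)
  set t := √(x - 2)
  have hpq : (p * q) ^ 2 = x ^ 2 - 1 := by rw [mul_pow, hp, hq]; ring
  have hrt : (r * t) ^ 2 = x ^ 2 - 4 := by rw [mul_pow, hr, ht]; ring
  have geometric_mean_bound : 3 * x + r * t ≤ 4 * (p * q) := by
    apply (sq_le_sq₀ (by positivity) (by positivity)).mp
    nlinarith [sq_nonneg (x - r * t)]
  apply (sq_le_sq₀ (by positivity) (by positivity)).mp
  nlinarith [sq_nonneg (2 * y - (r + t))]

/-- A lower bound for the fourth central difference of the square root. -/
lemma neg_sqrt_two_le_sqrt_fourth_difference {x : ℝ} (hx : 2 ≤ x) :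
    -√2 ≤ 6 * √x - 4 * √(x + 1) - 4 * √(x - 1) + √(x + 2) + √(x - 2) := by
  have hy := Real.sq_sqrt (show 0 ≤ x by linarith)
  have hp := Real.sq_sqrt (show 0 ≤ x + 1 by linarith)
  have hq := Real.sq_sqrt (show 0 ≤ x - 1 by linarith)
  have ht := Real.sq_sqrt (show 0 ≤ x - 2 by linarith)
  have h2 := Real.sq_sqrt (show (0 : ℝ) ≤ 2 by norm_num)
  have hyr : √x ≤ √(x + 2) := Real.sqrt_le_sqrt (by linarith)
  have h2y : √2 ≤ √x := Real.sqrt_le_sqrt hx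
  have hy0 := Real.sqrt_nonneg x
  have ht0 := Real.sqrt_nonneg (x - 2)
  have h20 := Real.sqrt_nonneg 2
  have midpoint : √(x + 1) + √(x - 1) ≤ 2 * √x := by
    apply (sq_le_sq₀ (by positivity) (by positivity)).mp
    nlinarith [sq_nonneg (√(x + 1) - √(x - 1))]
  have subadditive : √x ≤ √2 + √(x - 2) := by
    apply (sq_le_sq₀ (by positivity) (by positivity)).mp
    nlinarith [mul_nonneg h20 ht0]
  linarith

/-- The diagonal coefficients in terms of a fourth central difference of the square root. -/
lemma Q_diag (j k : ℕ) :
    Q j k k = 2 / √π * (2 : ℝ) ^ ((j : ℝ) / 2) *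
      ((6 * √(4 * (k : ℝ) - 2) - 4 * √(4 * (k : ℝ) - 2 + 1) - 4 * √(4 * (k : ℝ) - 2 - 1)
        + √(4 * (k : ℝ) - 2 + 2) + √(4 * (k : ℝ) - 2 - 2)) / 4 + (4 - √2) / 2) := by
  obtain ⟨D, hD⟩ : ∃ D : ℝ, D = 2 ^ (j + 1) := ⟨_, rfl⟩
  have hD0 : 0 < D := by rw [hD]; positivity
  obtain ⟨z, hz⟩ : ∃ z : ℝ, z = (2 : ℝ) ^ ((j : ℝ) / 2) := ⟨_, rfl⟩
  have hz0 : 0 < z := by rw [hz]; positivity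
  have hzz : (2 : ℝ) ^ j = z ^ 2 := by
    rw [hz, ← Real.rpow_natCast, ← Real.rpow_natCast, ← Real.rpow_mul (by norm_num)]
    congr 1
    push_cast
    ring
  have hsD : √D = √2 * z := by
    rw [hD, pow_succ, hzz, mul_comm, Real.sqrt_mul (by norm_num), Real.sqrt_sq hz0.le]
  have hR (u v : ℝ) : R (u / D) (v / D) =
      (√(u + v) - √|u - v|) / (√2 * √π * (√2 * z)) := by
    rw [R, ← add_div, ← sub_div, abs_div, abs_of_pos hD0, Real.sqrt_div' _ hD0.le,
      Real.sqrt_div' _ hD0.le, hsD, Real.sqrt_mul (by norm_num)]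
    field_simp
  have h2 : √2 ^ 2 = 2 := Real.sq_sqrt (by norm_num)
  have hpi : 0 < √π := Real.sqrt_pos.mpr Real.pi_pos
  simp only [Q, a, c, Finset.sum_range_succ, Finset.sum_range_zero, ← hD, hR, hzz, ← hz]
  norm_num
  ring_nf
  norm_num
  field_simp
  ring

theorem stmt_4 :
    ∃ m : ℝ, 0 < m ∧ ∀ j : ℕ, 1 ≤ j → ∀ k ∈ Finset.Icc 1 (2 ^ j),
      m * (2 : ℝ) ^ ((j : ℝ) / 2) ≤ Q j k k ∧
      Q j k k ≤ ((4 - Real.sqrt 2) / Real.sqrt Real.pi) * (2 : ℝ) ^ ((j : ℝ) / 2) := by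
  have h2 : √2 ^ 2 = 2 := Real.sq_sqrt (by norm_num)
  have h20 := Real.sqrt_nonneg 2
  have hs : 0 < 2 - 3 * √2 / 4 := by nlinarith
  have hpi : 0 < √π := Real.sqrt_pos.mpr Real.pi_pos
  refine ⟨2 / √π * (2 - 3 * √2 / 4), by positivity, fun j _ k hk => ?_⟩
  have hk1 : (1 : ℝ) ≤ k := by exact_mod_cast (Finset.mem_Icc.mp hk).1
  have hx : (2 : ℝ) ≤ 4 * k - 2 := by linarith
  have lower := neg_sqrt_two_le_sqrt_fourth_difference hx
  have upper := sqrt_fourth_difference_nonpos hx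
  have hfac : 0 ≤ 2 / √π * (2 : ℝ) ^ ((j : ℝ) / 2) := by positivity
  rw [Q_diag]
  constructor
  · rw [mul_right_comm]
    exact mul_le_mul_of_nonneg_left (by linarith) hfac
  · rw [show (4 - √2) / √π * (2 : ℝ) ^ ((j : ℝ) / 2) =
      2 / √π * (2 : ℝ) ^ ((j : ℝ) / 2) * ((4 - √2) / 2) by ring]
    exact mul_le_mul_of_nonneg_left (by linarith) hfac
end

section
/- There exists a constant M > 0 such that for every j ≥ 1, Σ_{k,k'=1}^{2^j} Q_{j,k,k'}² / (Q_{j,k,k} · Q_{j,k',k'}) ≤ M · 2^j; that is, the sum over k, k' of the squared correlation coefficients of the normalized coefficients v_{jk} = u_{jk}/√(Q_{j,k,k}) is at most M·2^j. -/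
open MeasureTheory Real Finset

/-- Fourth central difference of `x ↦ √|x|`. -/
noncomputable def sqrtAbsDiff4 (x : ℝ) : ℝ :=
  √|x - 2| - 4 * √|x - 1| + 6 * √|x| - 4 * √|x + 1| + √|x + 2|

theorem sqrtAbsDiff4_neg (x : ℝ) : sqrtAbsDiff4 (-x) = sqrtAbsDiff4 x := by
  unfold sqrtAbsDiff4
  rw [show -x - 2 = -(x + 2) by ring, show -x - 1 = -(x + 1) by ring,
    show -x + 1 = -(x - 1) by ring, show -x + 2 = -(x - 2) by ring]
  simp only [abs_neg]
  ring

theorem sqrtAbsDiff4_abs (x : ℝ) : sqrtAbsDiff4 |x| = sqrtAbsDiff4 x := by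
  rcases abs_choice x with h | h <;> rw [h]
  exact sqrtAbsDiff4_neg x

theorem sqrtAbsDiff4_zero : sqrtAbsDiff4 0 ≤ -5 := by
  have h2 : √(2 : ℝ) ≤ 3 / 2 := by
    rw [Real.sqrt_le_left (by norm_num)]
    norm_num
  norm_num [sqrtAbsDiff4]
  linarith

theorem sqrt_diff2_bounds {x : ℝ} (hx : 1 ≤ x) :
    -(2 / x) ≤ √(x + 1) - 2 * √x + √(x - 1) ∧ √(x + 1) - 2 * √x + √(x - 1) ≤ 0 := by
  set u := √(x + 1) with hu
  set v := √x with hv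
  set w := √(x - 1) with hw
  have hu2 : u ^ 2 = x + 1 := Real.sq_sqrt (by linarith)
  have hv2 : v ^ 2 = x := Real.sq_sqrt (by linarith)
  have hw2 : w ^ 2 = x - 1 := Real.sq_sqrt (by linarith)
  have hw0 : 0 ≤ w := Real.sqrt_nonneg _
  have hv1 : 1 ≤ v := Real.one_le_sqrt.mpr hx
  have huv : v ≤ u := Real.sqrt_le_sqrt (by linarith)
  have hprod : (u - 2 * v + w) * ((u + v) * (v + w) * (u + w)) = -2 := by
    have h1 : (u - v) * (u + v) = 1 := by linear_combination hu2 - hv2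
    have h2 : (v - w) * (v + w) = 1 := by linear_combination hv2 - hw2
    have h3 : (u - w) * (u + w) = 2 := by linear_combination hu2 - hw2
    linear_combination (v + w) * (u + w) * h1 - (u + v) * (u + w) * h2 - h3
  have hP : x ≤ (u + v) * (v + w) * (u + w) := by
    have h1 : v * v ≤ (u + v) * (v + w) :=
      mul_le_mul (by linarith) (by linarith) (by linarith) (by linarith)
    have h2 : v * v * 1 ≤ (u + v) * (v + w) * (u + w) :=
      mul_le_mul h1 (by linarith) (by norm_num) (by positivity)
    nlinarith
  have hPpos : 0 < (u + v) * (v + w) * (u + w) := by linarith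
  have heq : u - 2 * v + w = -(2 / ((u + v) * (v + w) * (u + w))) := by
    rw [← neg_div, eq_div_iff hPpos.ne', hprod]
  rw [heq]
  constructor
  · apply neg_le_neg
    gcongr
  · rw [neg_nonpos]
    positivity

theorem abs_sqrtAbsDiff4_le {x : ℝ} (hx : 2 ≤ x) : |sqrtAbsDiff4 x| ≤ 4 / (x - 1) := by
  obtain ⟨l0, u0⟩ := sqrt_diff2_bounds (x := x) (by linarith)
  obtain ⟨l1, u1⟩ := sqrt_diff2_bounds (x := x - 1) (by linarith)
  obtain ⟨l2, u2⟩ := sqrt_diff2_bounds (x := x + 1) (by linarith)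
  have h0 : 2 / x ≤ 2 / (x - 1) := by
    apply div_le_div_of_nonneg_left <;> linarith
  have h2 : 2 / (x + 1) ≤ 2 / (x - 1) := by
    apply div_le_div_of_nonneg_left <;> linarith
  have h4 : 4 / (x - 1) = 2 * (2 / (x - 1)) := by ring
  rw [show x - 1 + 1 = x by ring, show x - 1 - 1 = x - 2 by ring] at l1 u1
  rw [show x + 1 + 1 = x + 2 by ring, show x + 1 - 1 = x by ring] at l2 u2
  unfold sqrtAbsDiff4
  rw [abs_of_nonneg (show 0 ≤ x - 2 by linarith), abs_of_nonneg (show 0 ≤ x - 1 by linarith),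
    abs_of_nonneg (show 0 ≤ x by linarith), abs_of_nonneg (show 0 ≤ x + 1 by linarith),
    abs_of_nonneg (show 0 ≤ x + 2 by linarith), abs_le, h4]
  constructor <;> linarith

theorem abs_sqrtAbsDiff4_le_of_le {x y : ℝ} (hx : 2 ≤ x) (hxy : x ≤ y) :
    |sqrtAbsDiff4 y| ≤ 8 / x := by
  refine (abs_sqrtAbsDiff4_le (hx.trans hxy)).trans ?_
  rw [div_le_div_iff₀ (by linarith) (by linarith)]
  linarith

theorem R_mul_mul {h : ℝ} (hh : 0 ≤ h) {x y : ℝ} (hxy : 0 ≤ x + y) :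
    R (x * h) (y * h) = 1 / √(2 * π) * √h * (√|x + y| - √|x - y|) := by
  unfold R
  rw [← add_mul, ← sub_mul, abs_mul, abs_of_nonneg hh, abs_of_nonneg hxy,
    Real.sqrt_mul' _ hh, Real.sqrt_mul' _ hh]
  ring

/-- The covariance of the Schauder coefficients, normalized by its scale factor. -/
noncomputable def normQ (k k' : ℕ) : ℝ :=
  sqrtAbsDiff4 (2 * k + 2 * k' - 2) - sqrtAbsDiff4 (2 * k - 2 * k')

theorem exists_Q_eq (j : ℕ) :
    ∃ K : ℝ, 0 < K ∧ ∀ k k' : ℕ, 1 ≤ k → 1 ≤ k' → Q j k k' = K * normQ k k' := by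
  refine ⟨2 ^ j * (1 / √(2 * π) * √((2 ^ (j + 1))⁻¹)), by positivity, fun k k' hk hk' => ?_⟩
  have hk : (1 : ℝ) ≤ k := by exact_mod_cast hk
  have hk' : (1 : ℝ) ≤ k' := by exact_mod_cast hk'
  have hh : (0 : ℝ) ≤ (2 ^ (j + 1))⁻¹ := by positivity
  simp only [Q, Finset.sum_range_succ, Finset.sum_range_zero, a, c,
    div_eq_mul_inv _ ((2 : ℝ) ^ (j + 1))]
  norm_num only [if_true, if_false]
  repeat rw [R_mul_mul (by positivity) (by linarith)]
  simp only [normQ, sqrtAbsDiff4]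
  ring_nf

theorem one_le_normQ_self {k : ℕ} (hk : 1 ≤ k) : 1 ≤ normQ k k := by
  have hk : (1 : ℝ) ≤ k := by exact_mod_cast hk
  have h := abs_le.mp (abs_sqrtAbsDiff4_le_of_le le_rfl
    (show (2 : ℝ) ≤ 2 * k + 2 * k - 2 by linarith))
  have h0 := sqrtAbsDiff4_zero
  rw [normQ, sub_self]
  linarith [h.1]

theorem abs_normQ_le {k k' : ℕ} (hk : 1 ≤ k) (hk' : 1 ≤ k') (hne : k ≠ k') :
    |normQ k k'| ≤ 8 / |(k : ℝ) - k'| := by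
  have hd : (1 : ℝ) ≤ |(k : ℝ) - k'| := by
    have : (1 : ℤ) ≤ |(k : ℤ) - k'| := Int.one_le_abs (by omega)
    exact_mod_cast this
  have hk : (1 : ℝ) ≤ k := by exact_mod_cast hk
  have hk' : (1 : ℝ) ≤ k' := by exact_mod_cast hk'
  have hle : 2 * |(k : ℝ) - k'| ≤ 2 * k + 2 * k' - 2 := by
    rcases abs_cases ((k : ℝ) - k') with h | h <;> linarith
  have h1 := abs_sqrtAbsDiff4_le_of_le (show 2 ≤ 2 * |(k : ℝ) - k'| by linarith) hle
  have h2 := abs_sqrtAbsDiff4_le_of_le (show 2 ≤ 2 * |(k : ℝ) - k'| by linarith) le_rfl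
  have h3 : sqrtAbsDiff4 (2 * |(k : ℝ) - k'|) = sqrtAbsDiff4 (2 * k - 2 * k') := by
    rw [← mul_sub, ← sqrtAbsDiff4_abs (2 * ((k : ℝ) - k')), abs_mul, abs_two]
  rw [h3] at h2
  have h4 : 8 / |(k : ℝ) - k'| = 8 / (2 * |(k : ℝ) - k'|) + 8 / (2 * |(k : ℝ) - k'|) := by
    field_simp
    norm_num
  rw [h4]
  exact (abs_sub _ _).trans (add_le_add h1 h2)

theorem sq_correlation_le {j k k' : ℕ} (hk : 1 ≤ k) (hk' : 1 ≤ k') :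
    Q j k k' ^ 2 / (Q j k k * Q j k' k') ≤
      (if k = k' then 1 else 0) + 64 * (1 / (((k : ℤ) - k' : ℤ) : ℝ) ^ 2) := by
  obtain ⟨K, hK, hQ⟩ := exists_Q_eq j
  have p := one_le_normQ_self hk
  have p' := one_le_normQ_self hk'
  rw [hQ k k' hk hk', hQ k k hk hk, hQ k' k' hk' hk']
  by_cases h : k = k'
  · subst h
    rw [← sq, div_self (by positivity)]
    simp
  · have hb := abs_normQ_le hk hk' h
    have hsq : normQ k k' ^ 2 ≤ 64 * (1 / ((k : ℝ) - k') ^ 2) := by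
      calc normQ k k' ^ 2 = |normQ k k'| ^ 2 := (sq_abs _).symm
        _ ≤ (8 / |(k : ℝ) - k'|) ^ 2 := by gcongr
        _ = 64 * (1 / ((k : ℝ) - k') ^ 2) := by rw [div_pow, sq_abs]; ring
    have hpp : 1 ≤ normQ k k * normQ k' k' := one_le_mul_of_one_le_of_one_le p p'
    rw [show (K * normQ k k') ^ 2 / (K * normQ k k * (K * normQ k' k')) =
      normQ k k' ^ 2 / (normQ k k * normQ k' k') by field_simp, if_neg h, zero_add]
    push_cast
    exact (div_le_self (sq_nonneg _) hpp).trans hsq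

theorem sum_one_div_sub_sq_le (k : ℕ) (s : Finset ℕ) :
    ∑ k' ∈ s, 1 / (((k : ℤ) - k' : ℤ) : ℝ) ^ 2 ≤ ∑' n : ℤ, 1 / (n : ℝ) ^ 2 := by
  have hinj : Function.Injective fun k' : ℕ => (k : ℤ) - k' := fun x y hxy => by
    simpa using hxy
  refine (Finset.sum_map s ⟨_, hinj⟩ fun n : ℤ => 1 / (n : ℝ) ^ 2).symm.trans_le ?_
  exact (Real.summable_one_div_int_pow.mpr (by norm_num)).sum_le_tsum _
    fun n _ => by positivity

theorem stmt_5 :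
    ∃ M : ℝ, 0 < M ∧ ∀ j : ℕ, 1 ≤ j →
      ∑ k ∈ Finset.Icc 1 (2 ^ j), ∑ k' ∈ Finset.Icc 1 (2 ^ j),
        Q j k k' ^ 2 / (Q j k k * Q j k' k') ≤ M * 2 ^ j := by
  have hS : 0 ≤ ∑' n : ℤ, 1 / (n : ℝ) ^ 2 := tsum_nonneg fun n => by positivity
  refine ⟨1 + 64 * ∑' n : ℤ, 1 / (n : ℝ) ^ 2, by linarith, fun j _ => ?_⟩
  have hrow : ∀ k ∈ Finset.Icc 1 (2 ^ j), ∑ k' ∈ Finset.Icc 1 (2 ^ j),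
      Q j k k' ^ 2 / (Q j k k * Q j k' k') ≤ 1 + 64 * ∑' n : ℤ, 1 / (n : ℝ) ^ 2 := by
    intro k hk
    refine (Finset.sum_le_sum fun k' hk' => sq_correlation_le (Finset.mem_Icc.mp hk).1
      (Finset.mem_Icc.mp hk').1).trans ?_
    rw [Finset.sum_add_distrib, Finset.sum_ite_eq, if_pos hk, ← Finset.mul_sum]
    linarith [sum_one_div_sub_sq_le k (Finset.Icc 1 (2 ^ j))]
  refine (Finset.sum_le_card_nsmul _ _ _ hrow).trans_eq ?_
  rw [Nat.card_Icc, nsmul_eq_mul]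
  push_cast
  simp [mul_comm]
end

section
/- Let (X,Y) be a centered Gaussian random vector (every linear combination αX + βY is Gaussian) with E[X²] = E[Y²] = 1, and set ρ = |E[XY]|. Let f, g : ℝ → ℝ be measurable functions with E[f(X)²] < ∞, E[g(Y)²] < ∞ and E[f(X)] = E[g(Y)] = 0. Then |E[f(X)g(Y)]| ≤ ρ (E[f(X)²])^{1/2} (E[g(Y)²])^{1/2}. Moreover, if f is an even function, then |E[f(X)g(Y)]| ≤ ρ² (E[f(X)²])^{1/2} (E[g(Y)²])^{1/2}. -/
open MeasureTheory ProbabilityTheory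

open scoped InnerProductSpace Nat

/-- A weighted Cauchy-Schwarz inequality for series starting at index `k`. -/
lemma abs_le_pow_mul_sqrt_of_hasSum {a b : ℕ → ℝ} {r A B S : ℝ} {k : ℕ} (hr : |r| ≤ 1)
    (ha : ∀ n < k, a n = 0) (hA : HasSum (fun n => 1 / (n ! : ℝ) * a n * a n) A)
    (hB : HasSum (fun n => 1 / (n ! : ℝ) * b n * b n) B)
    (hS : HasSum (fun n => r ^ n / (n ! : ℝ) * a n * b n) S) :
    |S| ≤ |r| ^ k * √A * √B := by
  have hnonneg (c : ℕ → ℝ) (n : ℕ) : 0 ≤ 1 / (n ! : ℝ) * c n * c n := by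
    rw [mul_assoc]
    exact mul_nonneg (by positivity) (mul_self_nonneg _)
  have hsq (n : ℕ) : √(n ! : ℝ) ^ 2 = n ! := Real.sq_sqrt (by positivity)
  have hsqrt (c : ℕ → ℝ) (n : ℕ) : (|c n| / √(n ! : ℝ)) ^ 2 = 1 / (n ! : ℝ) * c n * c n := by
    rw [div_pow, hsq, sq_abs]
    ring
  have hterm (n : ℕ) : |r ^ n / (n ! : ℝ) * a n * b n| ≤
      |r| ^ k * ((|a n| / √(n ! : ℝ)) * (|b n| / √(n ! : ℝ))) := by
    rcases lt_or_ge n k with hn | hn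
    · simp [ha n hn]
    · have h1 : |r| ^ n ≤ |r| ^ k := pow_le_pow_of_le_one (abs_nonneg r) hr hn
      rw [div_mul_div_comm, ← sq, hsq, abs_mul, abs_mul, abs_div, abs_pow, Nat.abs_cast]
      calc |r| ^ n / (n ! : ℝ) * |a n| * |b n| ≤ |r| ^ k / (n ! : ℝ) * |a n| * |b n| := by gcongr
        _ = _ := by ring
  refine le_of_tendsto hS.abs (Filter.Eventually.of_forall fun s => ?_)
  calc |∑ n ∈ s, r ^ n / (n ! : ℝ) * a n * b n|
      ≤ ∑ n ∈ s, |r ^ n / (n ! : ℝ) * a n * b n| := Finset.abs_sum_le_sum_abs _ _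
    _ ≤ ∑ n ∈ s, |r| ^ k * ((|a n| / √(n ! : ℝ)) * (|b n| / √(n ! : ℝ))) :=
        Finset.sum_le_sum fun n _ => hterm n
    _ = |r| ^ k * ∑ n ∈ s, (|a n| / √(n ! : ℝ)) * (|b n| / √(n ! : ℝ)) :=
        (Finset.mul_sum _ _ _).symm
    _ ≤ |r| ^ k * (√(∑ n ∈ s, (|a n| / √(n ! : ℝ)) ^ 2) *
          √(∑ n ∈ s, (|b n| / √(n ! : ℝ)) ^ 2)) := by
        gcongr
        exact Real.sum_mul_le_sqrt_mul_sqrt _ _ _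
    _ ≤ |r| ^ k * (√A * √B) := by
        simp_rw [hsqrt]
        gcongr
        · exact sum_le_hasSum s (fun n _ => hnonneg a n) hA
        · exact sum_le_hasSum s (fun n _ => hnonneg b n) hB
    _ = _ := (mul_assoc _ _ _).symm

lemma hasSum_sum_mul_exp (r : ℝ) (s t : Finset ℝ) (c d : ℝ → ℝ) :
    HasSum (fun n => r ^ n / (n ! : ℝ) * (∑ x ∈ s, c x * x ^ n) * ∑ y ∈ t, d y * y ^ n)
      (∑ x ∈ s, ∑ y ∈ t, c x * (d y * Real.exp (r * (x * y)))) := by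
  have h (x y : ℝ) : HasSum (fun n => c x * (d y * ((r * (x * y)) ^ n / (n ! : ℝ))))
      (c x * (d y * Real.exp (r * (x * y)))) := by
    rw [Real.exp_eq_exp_ℝ]
    exact ((NormedSpace.expSeries_div_hasSum_exp (r * (x * y))).mul_left _).mul_left _
  refine (hasSum_sum fun x (_ : x ∈ s) => hasSum_sum fun y (_ : y ∈ t) => h x y).congr_fun ?_
  intro n
  rw [mul_assoc, Finset.sum_mul_sum, Finset.mul_sum]
  refine Finset.sum_congr rfl fun x _ => ?_
  rw [Finset.mul_sum]
  refine Finset.sum_congr rfl fun y _ => ?_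
  rw [mul_pow, mul_pow]
  ring

section Hilbert

variable {H K : Type*} [NormedAddCommGroup H] [InnerProductSpace ℝ H]
  [NormedAddCommGroup K] [InnerProductSpace ℝ K]

lemma inner_sum_exp_kernel {e : ℝ → H} {e' : ℝ → H} {r : ℝ}
    (he : ∀ x y, ⟪e x, e' y⟫_ℝ = Real.exp (r * (x * y))) (c d : ℝ →₀ ℝ) :
    HasSum (fun n => r ^ n / (n ! : ℝ) * (∑ x ∈ c.support, c x * x ^ n) *
      ∑ y ∈ d.support, d y * y ^ n)
      ⟪Finsupp.linearCombination ℝ e c, Finsupp.linearCombination ℝ e' d⟫_ℝ := by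
  convert hasSum_sum_mul_exp r c.support d.support c d using 1
  simp only [Finsupp.linearCombination_apply, Finsupp.sum, sum_inner, inner_sum,
    real_inner_smul_left, real_inner_smul_right, he]
  rw [Finset.sum_comm]
  exact Finset.sum_congr rfl fun x _ => Finset.sum_congr rfl fun y _ => mul_left_comm _ _ _

/-- If two isometric copies of an exponential-kernel system have cross-kernel `exp (r x y)`,
the first copy of a combination whose moments below `k` vanish is `|r| ^ k`-correlated
with the second copy of any combination. -/
lemma abs_inner_linearCombination_le {e : ℝ → H} {r : ℝ} (hr : |r| ≤ 1)
    (he : ∀ x y, ⟪e x, e y⟫_ℝ = Real.exp (x * y)) (Φ Ψ : H →ₗᵢ[ℝ] K)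
    (hΦΨ : ∀ x y, ⟪Φ (e x), Ψ (e y)⟫_ℝ = Real.exp (r * (x * y))) {k : ℕ} {c : ℝ →₀ ℝ}
    (hc : ∀ n < k, Finsupp.linearCombination ℝ (fun x : ℝ => x ^ n) c = 0) (d : ℝ →₀ ℝ) :
    |⟪Φ (Finsupp.linearCombination ℝ e c), Ψ (Finsupp.linearCombination ℝ e d)⟫_ℝ| ≤
      |r| ^ k * ‖Finsupp.linearCombination ℝ e c‖ * ‖Finsupp.linearCombination ℝ e d‖ := by
  have hone (c : ℝ →₀ ℝ) := inner_sum_exp_kernel (r := 1) (by simpa using he) c c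
  simp only [one_pow] at hone
  have h := abs_le_pow_mul_sqrt_of_hasSum hr hc (hone c) (hone d)
    (inner_sum_exp_kernel (e := Φ ∘ e) (e' := Ψ ∘ e) hΦΨ c d)
  have hmap (Φ : H →ₗᵢ[ℝ] K) (c : ℝ →₀ ℝ) : Finsupp.linearCombination ℝ (Φ ∘ e) c =
      Φ (Finsupp.linearCombination ℝ e c) :=
    (Finsupp.apply_linearCombination ℝ Φ.toLinearMap e c).symm
  rwa [hmap, hmap, real_inner_self_eq_norm_sq, real_inner_self_eq_norm_sq,
    Real.sqrt_sq (norm_nonneg _), Real.sqrt_sq (norm_nonneg _)] at h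

lemma abs_inner_le_of_denseRange {e : ℝ → H} {r : ℝ} (hr : |r| ≤ 1)
    (he : ∀ x y, ⟪e x, e y⟫_ℝ = Real.exp (x * y)) (Φ Ψ : H →ₗᵢ[ℝ] K)
    (hΦΨ : ∀ x y, ⟪Φ (e x), Ψ (e y)⟫_ℝ = Real.exp (r * (x * y)))
    (hdense : DenseRange (Finsupp.linearCombination ℝ e)) {k : ℕ} (T : H →L[ℝ] H)
    (T' : (ℝ →₀ ℝ) → (ℝ →₀ ℝ))
    (hT : ∀ c, T (Finsupp.linearCombination ℝ e c) = Finsupp.linearCombination ℝ e (T' c))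
    (hT' : ∀ c, ∀ n < k, Finsupp.linearCombination ℝ (fun x : ℝ => x ^ n) (T' c) = 0)
    (u w : H) : |⟪Φ (T u), Ψ w⟫_ℝ| ≤ |r| ^ k * ‖T u‖ * ‖w‖ := by
  refine hdense.induction_on₂ (p := fun u w => |⟪Φ (T u), Ψ w⟫_ℝ| ≤ |r| ^ k * ‖T u‖ * ‖w‖)
    ?_ (fun c d => ?_) u w
  · have hΦ := Φ.continuous
    have hΨ := Ψ.continuous
    exact isClosed_le (by fun_prop) (by fun_prop)
  · rw [hT]
    exact abs_inner_linearCombination_le hr he Φ Ψ hΦΨ (hT' c) d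

lemma inner_zero_linearCombination {e : ℝ → H} (he : ∀ x y, ⟪e x, e y⟫_ℝ = Real.exp (x * y))
    (c : ℝ →₀ ℝ) : ⟪e 0, Finsupp.linearCombination ℝ e c⟫_ℝ =
      Finsupp.linearCombination ℝ (fun _ => (1 : ℝ)) c := by
  simp [Finsupp.linearCombination_apply, Finsupp.sum, inner_sum, real_inner_smul_right, he]

lemma abs_inner_le_of_inner_zero_eq_zero {e : ℝ → H} {r : ℝ} (hr : |r| ≤ 1)
    (he : ∀ x y, ⟪e x, e y⟫_ℝ = Real.exp (x * y)) (Φ Ψ : H →ₗᵢ[ℝ] K)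
    (hΦΨ : ∀ x y, ⟪Φ (e x), Ψ (e y)⟫_ℝ = Real.exp (r * (x * y)))
    (hdense : DenseRange (Finsupp.linearCombination ℝ e)) {u : H} (hu : ⟪e 0, u⟫_ℝ = 0) (w : H) :
    |⟪Φ u, Ψ w⟫_ℝ| ≤ |r| * ‖u‖ * ‖w‖ := by
  let T : H →L[ℝ] H := .id ℝ H - (innerSL ℝ (e 0)).smulRight (e 0)
  let T' (c : ℝ →₀ ℝ) : ℝ →₀ ℝ :=
    c - Finsupp.single 0 (Finsupp.linearCombination ℝ (fun _ => (1 : ℝ)) c)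
  have h := abs_inner_le_of_denseRange hr he Φ Ψ hΦΨ hdense (k := 1) T T'
    (fun c => by simp [T, T', inner_zero_linearCombination he])
    (fun c n hn => by
      obtain rfl : n = 0 := by lia
      simp [T']) u w
  simpa [T, hu] using h

lemma abs_inner_le_of_even {e : ℝ → H} {r : ℝ} (hr : |r| ≤ 1)
    (he : ∀ x y, ⟪e x, e y⟫_ℝ = Real.exp (x * y)) (Φ Ψ : H →ₗᵢ[ℝ] K)
    (hΦΨ : ∀ x y, ⟪Φ (e x), Ψ (e y)⟫_ℝ = Real.exp (r * (x * y)))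
    (hdense : DenseRange (Finsupp.linearCombination ℝ e)) {S : H →L[ℝ] H}
    (hS : ∀ x, S (e x) = e (-x)) {u : H} (hu : ⟪e 0, u⟫_ℝ = 0) (hSu : S u = u) (w : H) :
    |⟪Φ u, Ψ w⟫_ℝ| ≤ |r| ^ 2 * ‖u‖ * ‖w‖ := by
  let T : H →L[ℝ] H :=
    (2⁻¹ : ℝ) • (.id ℝ H + S) - (innerSL ℝ (e 0)).smulRight (e 0)
  let T' (c : ℝ →₀ ℝ) : ℝ →₀ ℝ :=
    (2⁻¹ : ℝ) • (c + c.mapDomain Neg.neg) -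
      Finsupp.single 0 (Finsupp.linearCombination ℝ (fun _ => (1 : ℝ)) c)
  have hSc (c : ℝ →₀ ℝ) : S (Finsupp.linearCombination ℝ e c) =
      Finsupp.linearCombination ℝ (e ∘ Neg.neg) c := by
    refine (Finsupp.apply_linearCombination ℝ S.toLinearMap e c).trans ?_
    congr 2
    exact funext hS
  have h := abs_inner_le_of_denseRange hr he Φ Ψ hΦΨ hdense (k := 2) T T'
    (fun c => by
      simp [T, T', inner_zero_linearCombination he, hSc, Finsupp.linearCombination_mapDomain])
    (fun c n hn => by
      have hn' : n = 0 ∨ n = 1 := by lia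
      rcases hn' with rfl | rfl
      · simp only [T', map_sub, map_smul, map_add, Finsupp.linearCombination_mapDomain,
          Finsupp.linearCombination_single, pow_zero, Function.comp_def, smul_eq_mul]
        ring
      · have hodd : Finsupp.linearCombination ℝ ((fun x : ℝ => x ^ 1) ∘ Neg.neg) c =
            -Finsupp.linearCombination ℝ (fun x : ℝ => x ^ 1) c := by
          simp [Finsupp.linearCombination_apply, Finsupp.sum]
        simp only [T', map_sub, map_smul, map_add, Finsupp.linearCombination_mapDomain,
          Finsupp.linearCombination_single, hodd]
        simp) u w
  have hTu : T u = u := by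
    simp only [T, sub_apply, smul_apply, add_apply, ContinuousLinearMap.id_apply, hSu,
      ContinuousLinearMap.smulRight_apply, innerSL_apply_apply, hu, zero_smul, sub_zero]
    rw [← two_smul ℝ u, smul_smul]
    norm_num
  rwa [hTu] at h

end Hilbert

/-- A function whose bilateral Laplace transform vanishes identically is zero. -/
lemma ae_eq_zero_of_integral_mul_exp_eq_zero {μ : Measure ℝ} {u : ℝ → ℝ} (hu : Measurable u)
    (hint : ∀ t, Integrable (fun x => u x * Real.exp (t * x)) μ)
    (hzero : ∀ t, ∫ x, u x * Real.exp (t * x) ∂μ = 0) : u =ᵐ[μ] 0 := by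
  have hu_int : Integrable u μ := by simpa using hint 0
  let ν (w : ℝ → ℝ) : Measure ℝ := μ.withDensity fun x => ENNReal.ofReal (w x)
  have hfin (w : ℝ → ℝ) (hw : Integrable w μ) : IsFiniteMeasure (ν w) :=
    isFiniteMeasure_withDensity_ofReal hw.2
  have hmgf (w : ℝ → ℝ) (hw : Measurable w) (t : ℝ) :
      mgf id (ν w) t = ∫ x, max (w x) 0 * Real.exp (t * x) ∂μ := by
    simp only [mgf, ν]
    rw [integral_withDensity_eq_integral_toReal_smul hw.ennreal_ofReal (by simp)]
    simp [ENNReal.toReal_ofReal']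
  have hmax (w : ℝ → ℝ) (t : ℝ) (hw : Integrable (fun x => w x * Real.exp (t * x)) μ) :
      Integrable (fun x => max (w x) 0 * Real.exp (t * x)) μ := by
    convert hw.pos_part using 2 with x
    rw [max_mul_of_nonneg _ _ (Real.exp_pos _).le, zero_mul]
  have hneg (t : ℝ) : Integrable (fun x => (-u) x * Real.exp (t * x)) μ := by
    simpa using (hint t).neg
  have hset (w : ℝ → ℝ) (hw : Measurable w)
      (hwi : ∀ t, Integrable (fun x => w x * Real.exp (t * x)) μ) :
      integrableExpSet id (ν w) = Set.univ := by
    ext t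
    simp only [integrableExpSet, ν, Set.mem_univ, iff_true, Set.mem_ofPred_eq]
    rw [integrable_withDensity_iff_integrable_smul' hw.ennreal_ofReal (by simp)]
    simpa [ENNReal.toReal_ofReal'] using hmax w t (hwi t)
  have heq : mgf id (ν u) = mgf id (ν (-u)) := by
    ext t
    rw [hmgf u hu, hmgf (-u) hu.neg, ← sub_eq_zero,
      ← integral_sub (hmax u t (hint t)) (hmax (-u) t (hneg t))]
    refine Eq.trans ?_ (hzero t)
    congr with x
    rw [← sub_mul, Pi.neg_apply]
    congr 1
    exact posPart_sub_negPart (u x)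
  have := hfin u hu_int
  have := hfin (-u) hu_int.neg
  have hnull : ν u = 0 ↔ ν (-u) = 0 := by
    have h0 := congrFun heq 0
    simp only [mgf_zero', Measure.real] at h0
    rw [ENNReal.toReal_eq_toReal_iff' (measure_ne_top _ _) (measure_ne_top _ _)] at h0
    rw [← Measure.measure_univ_eq_zero, ← Measure.measure_univ_eq_zero, h0]
  have hν : ν u = ν (-u) := by
    refine Measure.ext_of_complexMGF_id_eq (funext fun z => ?_)
    refine eqOn_complexMGF_of_mgf' heq hnull ?_
    simp [hset u hu hint]
  rw [withDensity_eq_iff hu.ennreal_ofReal.aemeasurable hu.neg.ennreal_ofReal.aemeasurable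
    hu_int.lintegral_lt_top.ne] at hν
  filter_upwards [hν] with x hx
  have h := congrArg ENNReal.toReal hx
  simp only [ENNReal.toReal_ofReal', Pi.neg_apply] at h
  rw [← posPart_sub_negPart (u x)]
  exact sub_eq_zero.2 h

local notation "γ" => gaussianReal 0 1

lemma memLp_exp_mul_sub_gaussianReal (t : ℝ) :
    MemLp (fun x => Real.exp (t * x - t ^ 2 / 2)) 2 γ := by
  rw [memLp_two_iff_integrable_sq (by fun_prop)]
  convert (integrable_exp_mul_gaussianReal (μ := 0) (v := 1) (2 * t)).const_mul
    (Real.exp (-t ^ 2)) using 2 with x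
  rw [← Real.exp_nat_mul, ← Real.exp_add]
  push_cast
  ring_nf

/-- The normalised exponential `x ↦ exp (t x - t² / 2)` in `L²` of the standard Gaussian. -/
noncomputable def gaussianExp (t : ℝ) : Lp ℝ 2 γ :=
  (memLp_exp_mul_sub_gaussianReal t).toLp

lemma denseRange_linearCombination_gaussianExp :
    DenseRange (Finsupp.linearCombination ℝ gaussianExp) := by
  have htop : (LinearMap.range (Finsupp.linearCombination ℝ gaussianExp)).topologicalClosure
      = ⊤ := by
    rw [Submodule.topologicalClosure_eq_top_iff, Submodule.eq_bot_iff]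
    intro u hu
    rw [Submodule.mem_orthogonal] at hu
    have hmem (t : ℝ) := memLp_exp_mul_sub_gaussianReal t
    have hexp (t x : ℝ) : u x * Real.exp (t * x) =
        Real.exp (t ^ 2 / 2) * (u x * Real.exp (t * x - t ^ 2 / 2)) := by
      rw [mul_left_comm, ← Real.exp_add]
      ring_nf
    refine (Lp.eq_zero_iff_ae_eq_zero).2 <| ae_eq_zero_of_integral_mul_exp_eq_zero
      (Lp.stronglyMeasurable u).measurable (fun t => ?_) fun t => ?_
    · simp_rw [hexp]
      exact ((Lp.memLp u).integrable_mul (hmem t)).const_mul _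
    · simp_rw [hexp]
      rw [integral_const_mul]
      have h := hu (gaussianExp t) ⟨Finsupp.single t 1, by simp⟩
      rw [L2.inner_def] at h
      rw [mul_eq_zero]
      right
      refine Eq.trans (integral_congr_ae ?_) h
      filter_upwards [(hmem t).coeFn_toLp] with x hx
      simp [gaussianExp, hx]
  rw [DenseRange, ← LinearMap.coe_range]
  exact Submodule.dense_iff_topologicalClosure_eq_top.2 htop

section Pair

variable {Ω : Type*} [MeasurableSpace Ω] {P : Measure Ω}

lemma inner_toLp_eq_integral {u w : Ω → ℝ} (hu : MemLp u 2 P) (hw : MemLp w 2 P) :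
    ⟪hu.toLp, hw.toLp⟫_ℝ = ∫ ω, u ω * w ω ∂P := by
  rw [L2.inner_def]
  refine integral_congr_ae ?_
  filter_upwards [hu.coeFn_toLp, hw.coeFn_toLp] with x hx hx'
  simp [hx, hx', mul_comm]

lemma norm_toLp_eq_sqrt_integral {u : Ω → ℝ} (hu : MemLp u 2 P) :
    ‖hu.toLp‖ = √(∫ ω, u ω ^ 2 ∂P) := by
  rw [norm_eq_sqrt_real_inner, inner_toLp_eq_integral]
  simp_rw [sq]

lemma integral_exp_mul_exp {X Y : Ω → ℝ} {x y : ℝ} {v : NNReal}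
    (hmap : P.map (fun ω => x * X ω + y * Y ω) = gaussianReal 0 v) :
    ∫ ω, Real.exp (x * X ω - x ^ 2 / 2) * Real.exp (y * Y ω - y ^ 2 / 2) ∂P =
      Real.exp ((v - x ^ 2 - y ^ 2) / 2) := by
  have h := mgf_gaussianReal hmap 1
  simp only [mgf, one_mul] at h
  have hexp (ω : Ω) : Real.exp (x * X ω - x ^ 2 / 2) * Real.exp (y * Y ω - y ^ 2 / 2) =
      Real.exp (-(x ^ 2 + y ^ 2) / 2) * Real.exp (x * X ω + y * Y ω) := by
    rw [← Real.exp_add, ← Real.exp_add]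
    ring_nf
  simp_rw [hexp]
  rw [integral_const_mul, h, ← Real.exp_add]
  ring_nf

lemma integral_sq_of_map_eq_gaussianReal {Z : Ω → ℝ} (hZ : Measurable Z) {v : NNReal}
    (hmap : P.map Z = gaussianReal 0 v) : ∫ ω, Z ω ^ 2 ∂P = v := by
  have h := variance_fun_id_gaussianReal (μ := 0) (v := v)
  rw [variance_eq_integral measurable_id'.aemeasurable, integral_id_gaussianReal, ← hmap,
    integral_map hZ.aemeasurable (by fun_prop)] at h
  simpa using h

lemma variance_add_eq {X Y : Ω → ℝ} (hX : Measurable X) (hY : Measurable Y)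
    (hX2 : ∫ ω, X ω ^ 2 ∂P = 1) (hY2 : ∫ ω, Y ω ^ 2 ∂P = 1) {x y : ℝ} {v : NNReal}
    (hmap : P.map (fun ω => x * X ω + y * Y ω) = gaussianReal 0 v) :
    (v : ℝ) = x ^ 2 + y ^ 2 + 2 * (x * y) * ∫ ω, X ω * Y ω ∂P := by
  have hXi : Integrable (fun ω => X ω ^ 2) P := .of_integral_ne_zero (by simp [hX2])
  have hYi : Integrable (fun ω => Y ω ^ 2) P := .of_integral_ne_zero (by simp [hY2])
  have hXY : Integrable (fun ω => X ω * Y ω) P :=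
    ((memLp_two_iff_integrable_sq hX.aestronglyMeasurable).2 hXi).integrable_mul
      ((memLp_two_iff_integrable_sq hY.aestronglyMeasurable).2 hYi)
  rw [← integral_sq_of_map_eq_gaussianReal (by fun_prop) hmap]
  have hexp (ω : Ω) : (x * X ω + y * Y ω) ^ 2 =
      x ^ 2 * X ω ^ 2 + y ^ 2 * Y ω ^ 2 + 2 * (x * y) * (X ω * Y ω) := by ring
  simp_rw [hexp]
  rw [integral_add (by fun_prop) (by fun_prop),
    integral_add (by fun_prop) (by fun_prop), integral_const_mul, integral_const_mul,
    integral_const_mul, hX2, hY2]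
  ring

end Pair

lemma inner_gaussianExp (x y : ℝ) : ⟪gaussianExp x, gaussianExp y⟫_ℝ = Real.exp (x * y) := by
  have hmap : (γ).map (fun ω => x * ω + y * ω) =
      gaussianReal 0 (.mk ((x + y) ^ 2) (sq_nonneg _)) := by
    simp_rw [← add_mul]
    simp [gaussianReal_map_const_mul]
  rw [gaussianExp, gaussianExp, inner_toLp_eq_integral, integral_exp_mul_exp hmap, NNReal.coe_mk]
  ring_nf



theorem stmt_6 {Ω : Type*} [MeasurableSpace Ω] (P : Measure Ω) [IsProbabilityMeasure P]
    (X Y : Ω → ℝ) (hX : Measurable X) (hY : Measurable Y)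
    -- (X, Y) is a centered Gaussian vector: every linear combination is centered Gaussian
    (hGauss : ∀ α β : ℝ, ∃ v : NNReal,
      Measure.map (fun ω => α * X ω + β * Y ω) P = gaussianReal 0 v)
    (hX2 : ∫ ω, (X ω) ^ 2 ∂P = 1) (hY2 : ∫ ω, (Y ω) ^ 2 ∂P = 1)
    (f g : ℝ → ℝ) (hf : Measurable f) (hg : Measurable g)
    (hfX2 : Integrable (fun ω => (f (X ω)) ^ 2) P)
    (hgY2 : Integrable (fun ω => (g (Y ω)) ^ 2) P)
    (hfc : ∫ ω, f (X ω) ∂P = 0) (hgc : ∫ ω, g (Y ω) ∂P = 0) :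
    |∫ ω, f (X ω) * g (Y ω) ∂P| ≤
      |∫ ω, X ω * Y ω ∂P| * Real.sqrt (∫ ω, (f (X ω)) ^ 2 ∂P) *
        Real.sqrt (∫ ω, (g (Y ω)) ^ 2 ∂P) ∧
    ((∀ x : ℝ, f (-x) = f x) →
      |∫ ω, f (X ω) * g (Y ω) ∂P| ≤
        |∫ ω, X ω * Y ω ∂P| ^ 2 * Real.sqrt (∫ ω, (f (X ω)) ^ 2 ∂P) *
          Real.sqrt (∫ ω, (g (Y ω)) ^ 2 ∂P)) := by
  set r := ∫ ω, X ω * Y ω ∂P with hr_def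
  have hv (α β : ℝ) : ∃ v : NNReal,
      P.map (fun ω => α * X ω + β * Y ω) = gaussianReal 0 v ∧
        (v : ℝ) = α ^ 2 + β ^ 2 + 2 * (α * β) * r := by
    obtain ⟨v, hmap⟩ := hGauss α β
    exact ⟨v, hmap, variance_add_eq hX hY hX2 hY2 hmap⟩
  have hr : |r| ≤ 1 := by
    obtain ⟨v, -, hv1⟩ := hv 1 1
    obtain ⟨v', -, hv2⟩ := hv 1 (-1)
    have := v.coe_nonneg
    have := v'.coe_nonneg
    exact abs_le.2 ⟨by linarith, by linarith⟩
  have hXmp : MeasurePreserving X P γ := by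
    obtain ⟨v, hmap, hv1⟩ := hv 1 0
    obtain rfl : v = 1 := NNReal.eq (by simpa using hv1)
    exact ⟨hX, by simpa using hmap⟩
  have hYmp : MeasurePreserving Y P γ := by
    obtain ⟨v, hmap, hv1⟩ := hv 0 1
    obtain rfl : v = 1 := NNReal.eq (by simpa using hv1)
    exact ⟨hY, by simpa using hmap⟩
  have hNmp : MeasurePreserving (Neg.neg : ℝ → ℝ) γ γ :=
    ⟨measurable_neg, by simpa using gaussianReal_map_neg (μ := 0) (v := 1)⟩
  let Φ := Lp.compMeasurePreservingₗᵢ ℝ (E := ℝ) (p := 2) X hXmp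
  let Ψ := Lp.compMeasurePreservingₗᵢ ℝ (E := ℝ) (p := 2) Y hYmp
  let S := (Lp.compMeasurePreservingₗᵢ ℝ (E := ℝ) (p := 2) Neg.neg hNmp).toContinuousLinearMap
  have hmem {Z : Ω → ℝ} (hZ : MeasurePreserving Z P γ) {h : ℝ → ℝ} (hh : Measurable h)
      (hi : Integrable (fun ω => h (Z ω) ^ 2) P) : MemLp h 2 γ := by
    rw [memLp_two_iff_integrable_sq hh.aestronglyMeasurable, ← hZ.map_eq,
      integrable_map_measure (by fun_prop) hZ.measurable.aemeasurable]
    exact hi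
  have hfL := hmem hXmp hf hfX2
  have hgL := hmem hYmp hg hgY2
  have hΦΨ (x y : ℝ) : ⟪Φ (gaussianExp x), Ψ (gaussianExp y)⟫_ℝ = Real.exp (r * (x * y)) := by
    obtain ⟨v, hmap, hv⟩ := hv x y
    have hx := (memLp_exp_mul_sub_gaussianReal x).comp_measurePreserving hXmp
    have hy := (memLp_exp_mul_sub_gaussianReal y).comp_measurePreserving hYmp
    refine (inner_toLp_eq_integral hx hy).trans ((integral_exp_mul_exp hmap).trans ?_)
    rw [hv]
    ring_nf
  have hinner : ⟪Φ hfL.toLp, Ψ hgL.toLp⟫_ℝ = ∫ ω, f (X ω) * g (Y ω) ∂P :=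
    inner_toLp_eq_integral (hfL.comp_measurePreserving hXmp) (hgL.comp_measurePreserving hYmp)
  have hnf : ‖hfL.toLp‖ = √(∫ ω, f (X ω) ^ 2 ∂P) :=
    (Φ.norm_map _).symm.trans (norm_toLp_eq_sqrt_integral (hfL.comp_measurePreserving hXmp))
  have hng : ‖hgL.toLp‖ = √(∫ ω, g (Y ω) ^ 2 ∂P) :=
    (Ψ.norm_map _).symm.trans (norm_toLp_eq_sqrt_integral (hgL.comp_measurePreserving hYmp))
  have hf0 : ⟪gaussianExp 0, hfL.toLp⟫_ℝ = 0 := by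
    rw [gaussianExp, inner_toLp_eq_integral, ← hXmp.map_eq,
      integral_map hX.aemeasurable (by fun_prop)]
    simpa using hfc
  rw [← hinner, ← hnf, ← hng]
  refine ⟨abs_inner_le_of_inner_zero_eq_zero hr inner_gaussianExp Φ Ψ hΦΨ
    denseRange_linearCombination_gaussianExp hf0 _, fun heven => ?_⟩
  refine abs_inner_le_of_even hr inner_gaussianExp Φ Ψ hΦΨ
    denseRange_linearCombination_gaussianExp (S := S) (fun x => ?_) hf0 ?_ _
  · refine (MemLp.toLp_eq_toLp_iff ((memLp_exp_mul_sub_gaussianReal x).comp_measurePreserving hNmp)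
      (memLp_exp_mul_sub_gaussianReal (-x))).2 (.of_forall fun y => ?_)
    simp
  · exact (MemLp.toLp_eq_toLp_iff (hfL.comp_measurePreserving hNmp) hfL).2 (.of_forall heven)
end

section
/- Let N ≥ 1 and let (v_1,…,v_N) be a centered Gaussian random vector (every linear combination of the v_k is Gaussian) with E[v_k²] = 1 for all k. Then for every real p ≥ 1, E[(Σ_{k=1}^{N} (|v_k|^p − c_p))²] ≤ (c_{2p} − c_p²) Σ_{k,k'=1}^{N} (E[v_k v_{k'}])², where c_q = (1/√(2π)) ∫_ℝ |x|^q e^{−x²/2} dx denotes the q-th absolute moment of a standard Gaussian. -/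
open MeasureTheory ProbabilityTheory

/-- `absMoment q` is the `q`-th absolute moment of a standard Gaussian:
`c_q = (1/√(2π)) ∫_ℝ |x|^q e^{−x²/2} dx`. -/
noncomputable def absMoment (q : ℝ) : ℝ :=
  (1 / Real.sqrt (2 * Real.pi)) * ∫ x : ℝ, |x| ^ q * Real.exp (-x ^ 2 / 2)

open Real in
lemma integrable_abs_rpow_mul_exp_neg_mul_sq {b q : ℝ} (hb : 0 < b) (hq : 0 ≤ q) :
    Integrable fun x : ℝ => |x| ^ q * rexp (-b * x ^ 2) := by
  obtain ⟨m, hm⟩ := exists_nat_ge q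
  have h1 : Integrable fun x : ℝ => rexp (-b * x ^ 2) := integrable_exp_neg_mul_sq hb
  have h2 : Integrable fun x : ℝ => x ^ (2 * m) * rexp (-b * x ^ 2) := by
    have := integrable_rpow_mul_exp_neg_mul_sq hb (s := ((2 * m : ℕ) : ℝ))
      (by have : (0 : ℝ) ≤ ((2 * m : ℕ) : ℝ) := Nat.cast_nonneg _
          linarith)
    simpa only [rpow_natCast] using this
  refine (h1.add h2).mono' (by fun_prop) (ae_of_all _ fun x => ?_)
  have h3 : |x| ^ q ≤ 1 + x ^ (2 * m) := by
    have h4 : x ^ (2 * m) = |x| ^ (2 * m) := by rw [pow_mul, pow_mul, sq_abs]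
    rw [h4]
    rcases le_total |x| 1 with h | h
    · have := rpow_le_one (abs_nonneg x) h hq
      have : 0 ≤ |x| ^ (2 * m) := by positivity
      linarith
    · have : |x| ^ q ≤ |x| ^ ((2 * m : ℕ) : ℝ) :=
        rpow_le_rpow_of_exponent_le h (by push_cast; linarith [hq.trans hm])
      rw [rpow_natCast] at this
      linarith
  rw [norm_of_nonneg (by positivity)]
  calc _ ≤ (1 + x ^ (2 * m)) * rexp (-b * x ^ 2) := by gcongr
    _ = _ := by simp [add_mul]

open Real in
lemma integrable_gaussianReal_iff {μ : ℝ} {f : ℝ → ℝ} :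
    Integrable f (gaussianReal μ 1) ↔ Integrable (fun x => gaussianPDFReal μ 1 x * f x) := by
  rw [gaussianReal_of_var_ne_zero _ one_ne_zero,
    integrable_withDensity_iff_integrable_smul' (measurable_gaussianPDF _ _)
      (ae_of_all _ fun _ => gaussianPDF_lt_top)]
  simp [toReal_gaussianPDF]

open Real in
lemma integrable_abs_rpow_mul_exp_gaussianReal {q t : ℝ} (hq : 0 ≤ q) (ht : t < 1 / 2) :
    Integrable (fun x => |x| ^ q * rexp (t * x ^ 2)) (gaussianReal 0 1) := by
  rw [integrable_gaussianReal_iff]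
  refine ((integrable_abs_rpow_mul_exp_neg_mul_sq (b := 1 / 2 - t) (by linarith) hq).const_mul
    (√(2 * π * (1 : NNReal)))⁻¹).congr (ae_of_all _ fun x => ?_)
  have : rexp (-(1 / 2 - t) * x ^ 2)
      = rexp (-(x - 0) ^ 2 / (2 * (1 : NNReal))) * rexp (t * x ^ 2) := by
    rw [← exp_add]
    congr 1
    push_cast
    ring
  simp only [gaussianPDFReal, this]
  ring

lemma integrable_abs_rpow_gaussianReal {q : ℝ} (hq : 0 ≤ q) :
    Integrable (fun x => |x| ^ q) (gaussianReal 0 1) := by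
  simpa using integrable_abs_rpow_mul_exp_gaussianReal hq (t := 0) (by norm_num)

open Real in
lemma absMoment_eq_integral_gaussianReal (q : ℝ) :
    absMoment q = ∫ x, |x| ^ q ∂gaussianReal 0 1 := by
  rw [integral_gaussianReal_eq_integral_smul one_ne_zero, absMoment, ← integral_const_mul]
  congr 1 with x
  simp only [gaussianPDFReal, smul_eq_mul]
  simp
  ring

/-- `U` and `V` are jointly Gaussian, standardized, with correlation `ρ`. -/
def IsStdGaussianPair {Ω : Type*} [MeasurableSpace Ω] (P : Measure Ω) (U V : Ω → ℝ) (ρ : ℝ) :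
    Prop :=
  ∀ α β : ℝ, P.map (fun ω => α * U ω + β * V ω)
    = gaussianReal 0 (Real.toNNReal (α ^ 2 + 2 * α * β * ρ + β ^ 2))

lemma IsStdGaussianPair.map_eq {Ω Ω' : Type*} [MeasurableSpace Ω] [MeasurableSpace Ω']
    {P : Measure Ω} {P' : Measure Ω'} [IsProbabilityMeasure P] [IsProbabilityMeasure P']
    {U V : Ω → ℝ} {U' V' : Ω' → ℝ} {ρ : ℝ}
    (hU : Measurable U) (hV : Measurable V) (hU' : Measurable U') (hV' : Measurable V')
    (h : IsStdGaussianPair P U V ρ) (h' : IsStdGaussianPair P' U' V' ρ) :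
    P.map (fun ω => (U ω, V ω)) = P'.map (fun ω => (U' ω, V' ω)) := by
  have : IsProbabilityMeasure (P.map (fun ω => (U ω, V ω))) :=
    Measure.isProbabilityMeasure_map (by fun_prop)
  have : IsProbabilityMeasure (P'.map (fun ω => (U' ω, V' ω))) :=
    Measure.isProbabilityMeasure_map (by fun_prop)
  refine Measure.ext_of_charFunDual ?_
  ext L
  rw [charFunDual_eq_charFun_map_one, charFunDual_eq_charFun_map_one,
    Measure.map_map (by fun_prop) (by fun_prop), Measure.map_map (by fun_prop) (by fun_prop)]
  have hL : ∀ x y : ℝ, L (x, y) = L (1, 0) * x + L (0, 1) * y := fun x y => by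
    have : (x, y) = x • ((1, 0) : ℝ × ℝ) + y • ((0, 1) : ℝ × ℝ) := by simp
    rw [this, map_add, map_smul, map_smul]
    simp [mul_comm]
  have e1 : (⇑L ∘ fun ω => (U ω, V ω)) = fun ω => L (1, 0) * U ω + L (0, 1) * V ω :=
    funext fun ω => hL _ _
  have e2 : (⇑L ∘ fun ω => (U' ω, V' ω)) = fun ω => L (1, 0) * U' ω + L (0, 1) * V' ω :=
    funext fun ω => hL _ _
  rw [e1, e2, h, h']

lemma map_add_prod_gaussianReal {X Y : Type*} [MeasurableSpace X] [MeasurableSpace Y]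
    {μ : Measure X} {ν : Measure Y} [IsProbabilityMeasure μ] [IsProbabilityMeasure ν]
    {f : X → ℝ} {g : Y → ℝ} (hf : Measurable f) (hg : Measurable g) {a b : NNReal}
    (hμ : μ.map f = gaussianReal 0 a) (hν : ν.map g = gaussianReal 0 b) :
    (μ.prod ν).map (fun w => f w.1 + g w.2) = gaussianReal 0 (a + b) := by
  have h := gaussianReal_add_gaussianReal_of_indepFun (P := μ.prod ν)
    (X := fun w => f w.1) (Y := fun w => g w.2) (indepFun_prod hf hg) (m₁ := 0) (m₂ := 0)
    (v₁ := a) (v₂ := b) ?_ ?_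
  · simpa [Pi.add_def] using h
  · rw [← hμ, ← Function.comp_def f, ← Measure.map_map hf measurable_fst, Measure.map_fst_prod]
    simp
  · rw [← hν, ← Function.comp_def g, ← Measure.map_map hg measurable_snd, Measure.map_snd_prod]
    simp

lemma map_mul_gaussianReal (a : ℝ) :
    (gaussianReal 0 1).map (fun x => a * x) = gaussianReal 0 (Real.toNNReal (a ^ 2)) := by
  have h := gaussianReal_map_const_mul (μ := 0) (v := 1) a
  rw [h]
  congr 1
  · simp
  · ext
    simp [sq_nonneg]

lemma isStdGaussianPair_prod {ρ : ℝ} (hρ : ρ ^ 2 ≤ 1) :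
    IsStdGaussianPair ((gaussianReal 0 1).prod (gaussianReal 0 1)) (fun w => w.1)
      (fun w => ρ * w.1 + √(1 - ρ ^ 2) * w.2) ρ := by
  intro α β
  have h := map_add_prod_gaussianReal (by fun_prop) (by fun_prop)
    (map_mul_gaussianReal (α + β * ρ)) (map_mul_gaussianReal (β * √(1 - ρ ^ 2)))
  rw [← Real.toNNReal_add (sq_nonneg _) (sq_nonneg _), mul_pow, Real.sq_sqrt (by linarith)] at h
  convert h using 2
  · ext w; ring
  · congr 1; ring

lemma isStdGaussianPair_prod_prod {ρ : ℝ} (hρ : ρ ^ 2 ≤ 1) :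
    IsStdGaussianPair
      ((gaussianReal 0 1).prod ((gaussianReal 0 1).prod (gaussianReal 0 1)))
      (fun w => ρ * w.1 + √(1 - ρ ^ 2) * w.2.1)
      (fun w => ρ * w.1 + √(1 - ρ ^ 2) * w.2.2) (ρ ^ 2) := by
  intro α β
  have h := map_add_prod_gaussianReal (by fun_prop) (by fun_prop)
    (map_mul_gaussianReal ((α + β) * ρ))
    (map_add_prod_gaussianReal (by fun_prop) (by fun_prop)
      (map_mul_gaussianReal (α * √(1 - ρ ^ 2))) (map_mul_gaussianReal (β * √(1 - ρ ^ 2))))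
  rw [← Real.toNNReal_add (sq_nonneg _) (sq_nonneg _),
    ← Real.toNNReal_add (sq_nonneg _) (by positivity), mul_pow, mul_pow, mul_pow,
    Real.sq_sqrt (by linarith)] at h
  convert h using 2
  · ext w; ring
  · congr 1; ring

lemma sq_integral_mul_le {X : Type*} [MeasurableSpace X] {μ : Measure X} {f g : X → ℝ}
    (hf : MemLp f 2 μ) (hg : MemLp g 2 μ) :
    (∫ x, f x * g x ∂μ) ^ 2 ≤ (∫ x, f x ^ 2 ∂μ) * ∫ x, g x ^ 2 ∂μ := by
  have h : ∀ s : ℝ, 0 ≤ (∫ x, f x ^ 2 ∂μ) * (s * s) + (2 * ∫ x, f x * g x ∂μ) * s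
      + ∫ x, g x ^ 2 ∂μ := fun s => by
    have h1 : 0 ≤ ∫ x, (s * f x + g x) ^ 2 ∂μ := integral_nonneg fun x => sq_nonneg _
    have h2 : ∫ x, (s * f x + g x) ^ 2 ∂μ
        = ∫ x, (s * s * f x ^ 2 + 2 * s * (f x * g x)) + g x ^ 2 ∂μ := by
      congr 1 with x; ring
    have i1 : Integrable (fun x => s * s * f x ^ 2) μ := hf.integrable_sq.const_mul (s * s)
    have i2 : Integrable (fun x => 2 * s * (f x * g x)) μ :=
      (hf.integrable_mul hg).const_mul (2 * s)
    have i3 : Integrable (fun x => s * s * f x ^ 2 + 2 * s * (f x * g x)) μ := i1.add i2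
    rw [h2, integral_add i3 hg.integrable_sq, integral_add i1 i2, integral_const_mul,
      integral_const_mul] at h1
    linarith
  have := discrim_le_zero h
  rw [discrim] at this
  linarith

/-- The covariance-type functional `ρ ↦ E[g(U) g(V)]` for a standard Gaussian pair `(U, V)` with
correlation `ρ`. -/
noncomputable def gaussCorr (g : ℝ → ℝ) (ρ : ℝ) : ℝ :=
  ∫ w : ℝ × ℝ, g w.1 * g (ρ * w.1 + √(1 - ρ ^ 2) * w.2)
    ∂((gaussianReal 0 1).prod (gaussianReal 0 1))

section Pair

variable {Ω : Type*} [MeasurableSpace Ω] {P : Measure Ω} {U V : Ω → ℝ} {ρ : ℝ} {g : ℝ → ℝ}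

lemma IsStdGaussianPair.map_fst (h : IsStdGaussianPair P U V ρ) :
    P.map U = gaussianReal 0 1 := by
  simpa using h 1 0

lemma IsStdGaussianPair.map_snd (h : IsStdGaussianPair P U V ρ) :
    P.map V = gaussianReal 0 1 := by
  simpa using h 0 1

lemma memLp_comp_of_map_eq_gaussianReal (hU : Measurable U) (hg : MemLp g 2 (gaussianReal 0 1))
    (h : P.map U = gaussianReal 0 1) : MemLp (fun ω => g (U ω)) 2 P :=
  hg.comp_measurePreserving ⟨hU, h⟩

lemma IsStdGaussianPair.integrable_mul (h : IsStdGaussianPair P U V ρ) (hU : Measurable U)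
    (hV : Measurable V) (hg : MemLp g 2 (gaussianReal 0 1)) :
    Integrable (fun ω => g (U ω) * g (V ω)) P :=
  (memLp_comp_of_map_eq_gaussianReal hU hg h.map_fst).integrable_mul
    (memLp_comp_of_map_eq_gaussianReal hV hg h.map_snd)

lemma IsStdGaussianPair.integral_mul_eq_gaussCorr [IsProbabilityMeasure P]
    (h : IsStdGaussianPair P U V ρ) (hU : Measurable U) (hV : Measurable V) (hρ : ρ ^ 2 ≤ 1)
    (hg : Measurable g) : ∫ ω, g (U ω) * g (V ω) ∂P = gaussCorr g ρ := by
  have hm : Measurable fun w : ℝ × ℝ => g w.1 * g w.2 := by fun_prop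
  have h1 := h.map_eq hU hV (by fun_prop) (by fun_prop) (isStdGaussianPair_prod hρ)
  have e1 := integral_map (μ := P) (φ := fun ω => (U ω, V ω)) (by fun_prop)
    hm.aestronglyMeasurable
  have e2 := integral_map (μ := (gaussianReal 0 1).prod (gaussianReal 0 1))
    (φ := fun w => (w.1, ρ * w.1 + √(1 - ρ ^ 2) * w.2)) (by fun_prop)
    hm.aestronglyMeasurable
  rw [h1, e2] at e1
  exact e1.symm

end Pair

section Corr

variable {g : ℝ → ℝ} {ρ : ℝ}

lemma gaussCorr_one : gaussCorr g 1 = ∫ x, g x ^ 2 ∂gaussianReal 0 1 := by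
  rw [gaussCorr]
  have := integral_fun_fst (μ := gaussianReal 0 1) (ν := gaussianReal 0 1) (fun x => g x ^ 2)
  simpa [sq] using this

lemma gaussCorr_eq_integral_mul (hρ : ρ ^ 2 ≤ 1) (hg2 : MemLp g 2 (gaussianReal 0 1)) :
    gaussCorr g ρ = ∫ x, g x * ∫ z, g (ρ * x + √(1 - ρ ^ 2) * z) ∂gaussianReal 0 1
      ∂gaussianReal 0 1 := by
  rw [gaussCorr, integral_prod _ ((isStdGaussianPair_prod hρ).integrable_mul (by fun_prop)
    (by fun_prop) hg2)]
  simp_rw [integral_const_mul]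

lemma sq_gaussCorr_le (hρ : ρ ^ 2 ≤ 1) (hg : Measurable g)
    (hg2 : MemLp g 2 (gaussianReal 0 1)) :
    gaussCorr g ρ ^ 2 ≤ (∫ x, g x ^ 2 ∂gaussianReal 0 1) * gaussCorr g (ρ ^ 2) := by
  set G : ℝ → ℝ := fun x => ∫ z, g (ρ * x + √(1 - ρ ^ 2) * z) ∂gaussianReal 0 1 with hG
  have hρ2 : (ρ ^ 2) ^ 2 ≤ 1 := pow_le_one₀ (sq_nonneg _) hρ
  have hpair := isStdGaussianPair_prod_prod hρ
  have hint := hpair.integrable_mul (by fun_prop) (by fun_prop) hg2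
  have key : ∀ x, ∫ y : ℝ × ℝ, g (ρ * x + √(1 - ρ ^ 2) * y.1) * g (ρ * x + √(1 - ρ ^ 2) * y.2)
      ∂((gaussianReal 0 1).prod (gaussianReal 0 1)) = G x ^ 2 := fun x => by
    rw [sq (G x)]
    exact integral_prod_mul (μ := gaussianReal 0 1) (ν := gaussianReal 0 1)
      (fun z => g (ρ * x + √(1 - ρ ^ 2) * z))
      (fun z => g (ρ * x + √(1 - ρ ^ 2) * z))
  have hGsq : Integrable (fun x => G x ^ 2) (gaussianReal 0 1) := by
    have := hint.integral_prod_left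
    simpa only [key] using this
  have hGm : AEStronglyMeasurable G (gaussianReal 0 1) := by
    have hm : Measurable fun w : ℝ × ℝ => g (ρ * w.1 + √(1 - ρ ^ 2) * w.2) := by fun_prop
    exact (hm.stronglyMeasurable.integral_prod_right' (ν := gaussianReal 0 1)).aestronglyMeasurable
  have hGint : ∫ x, G x ^ 2 ∂gaussianReal 0 1 = gaussCorr g (ρ ^ 2) := by
    rw [← hpair.integral_mul_eq_gaussCorr (by fun_prop) (by fun_prop) hρ2 hg, integral_prod _ hint]
    simp only [key]
  rw [gaussCorr_eq_integral_mul hρ hg2, ← hGint]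
  exact sq_integral_mul_le hg2 ((memLp_two_iff_integrable_sq hGm).2 hGsq)

end Corr

/-- A function of the correlation that is `O(ρ²)` at the origin and satisfies the Cauchy–Schwarz
inequality of a self-adjoint semigroup is bounded by its quadratic profile. -/
lemma le_mul_sq_of_sq_le {φ : ℝ → ℝ} {A C : ℝ} (hA : 0 ≤ A) (h1 : φ 1 = A)
    (hsq : ∀ ρ, ρ ^ 2 ≤ 1 → φ ρ ^ 2 ≤ A * φ (ρ ^ 2))
    (hC : ∀ ρ, |ρ| ≤ 1 / 4 → φ ρ ≤ C * ρ ^ 2) {ρ : ℝ} (hρ : ρ ^ 2 ≤ 1) :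
    φ ρ ≤ A * ρ ^ 2 := by
  rcases hρ.eq_or_lt with h | hlt
  · have := hsq ρ hρ
    rw [h, h1] at this
    rw [h, mul_one]
    nlinarith
  by_contra! hcon
  have hκ : 0 < φ ρ := lt_of_le_of_lt (by positivity) hcon
  have hApos : 0 < A := by
    rcases hA.eq_or_lt with h | h
    · have := hsq ρ hρ
      rw [← h, zero_mul] at this
      nlinarith
    · exact h
  have hρ0 : ρ ≠ 0 := by
    rintro rfl
    have := hC 0 (by norm_num)
    simp at this
    linarith
  have hρ2 : 0 < ρ ^ 2 := by positivity
  have hiter : ∀ k : ℕ, A * (φ ρ / A) ^ 2 ^ k ≤ φ (ρ ^ 2 ^ k) := by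
    intro k
    induction k with
    | zero => simp [mul_div_cancel₀ _ hApos.ne']
    | succ k ih =>
      have h2 := hsq (ρ ^ 2 ^ k) (by
        rw [← pow_mul, mul_comm, pow_mul]
        exact pow_le_one₀ hρ2.le hρ)
      have h3 : (A * (φ ρ / A) ^ 2 ^ k) ^ 2 ≤ φ (ρ ^ 2 ^ k) ^ 2 := by gcongr
      have h4 : (ρ ^ 2 ^ k) ^ 2 = ρ ^ 2 ^ (k + 1) := by rw [← pow_mul, pow_succ]
      have h5 : (A * (φ ρ / A) ^ 2 ^ k) ^ 2 = A * (A * (φ ρ / A) ^ 2 ^ (k + 1)) := by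
        rw [pow_succ 2 k, pow_mul]; ring
      rw [h4] at h2
      rw [h5] at h3
      exact le_of_mul_le_mul_left (h3.trans h2) hApos
  set θ := φ ρ / (A * ρ ^ 2) with hθ
  have hθ1 : 1 < θ := by rwa [hθ, one_lt_div (by positivity)]
  have hpow : Filter.Tendsto (fun k : ℕ => 2 ^ k) Filter.atTop Filter.atTop :=
    tendsto_pow_atTop_atTop_of_one_lt one_lt_two
  have t1 := (tendsto_pow_atTop_atTop_of_one_lt hθ1).comp hpow
  have habs : |ρ| < 1 := by
    rw [← sq_lt_one_iff_abs_lt_one]; exact hlt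
  have t2 := (tendsto_pow_atTop_nhds_zero_of_lt_one (abs_nonneg ρ) habs).comp hpow
  obtain ⟨k, hk1, hk2⟩ := ((t1.eventually_gt_atTop (C / A)).and
    (t2.eventually_le_const (show (0 : ℝ) < 1 / 4 by norm_num))).exists
  simp only [Function.comp] at hk1 hk2
  have h6 := (hiter k).trans (hC _ (by rwa [abs_pow]))
  have h7 : φ ρ / A = θ * ρ ^ 2 := by rw [hθ]; field_simp
  rw [h7, mul_pow, ← pow_mul, ← pow_mul, mul_comm 2, ← mul_assoc] at h6
  have h8 := le_of_mul_le_mul_right h6 (by rw [mul_comm, pow_mul]; positivity)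
  rw [div_lt_iff₀ hApos] at hk1
  linarith

open Real in
lemma exp_le_one_add_add_sq_mul (u : ℝ) : rexp u ≤ 1 + u + u ^ 2 * rexp |u| := by
  have h := Complex.norm_exp_sub_sum_le_norm_mul_exp (u : ℂ) 2
  simp only [Finset.sum_range_succ, Finset.sum_range_zero] at h
  norm_num at h
  rw [← Complex.ofReal_exp, ← Complex.ofReal_one, ← Complex.ofReal_add, ← Complex.ofReal_sub,
    Complex.norm_real, norm_eq_abs] at h
  linarith [(abs_le.1 h).2]

lemma abs_rpow_mul_sq {p : ℝ} (hp : 0 ≤ p) (x : ℝ) : |x| ^ p * x ^ 2 = |x| ^ (p + 2) := by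
  rw [Real.rpow_add_of_nonneg (abs_nonneg x) hp (by norm_num), ← sq_abs x]
  norm_num

lemma integrable_abs_rpow_mul_self {p : ℝ} (hp : 0 ≤ p) :
    Integrable (fun y => |y| ^ p * y) (gaussianReal 0 1) := by
  refine (integrable_abs_rpow_gaussianReal (q := p + 1) (by linarith)).mono' (by fun_prop)
    (ae_of_all _ fun y => ?_)
  rw [Real.rpow_add_of_nonneg (abs_nonneg y) hp zero_le_one, Real.rpow_one, norm_mul,
    Real.norm_eq_abs, Real.norm_eq_abs, abs_of_nonneg (by positivity)]

lemma integral_abs_rpow_mul_self (p : ℝ) :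
    ∫ y, |y| ^ p * y ∂gaussianReal 0 1 = 0 := by
  have h := integral_map (μ := gaussianReal 0 1) (φ := fun x : ℝ => -x) (by fun_prop)
    (f := fun y : ℝ => |y| ^ p * y) (by fun_prop)
  rw [gaussianReal_map_neg, neg_zero] at h
  simp only [abs_neg, mul_neg, integral_neg] at h
  linarith

open Real in
lemma integral_abs_add_rpow_le {p : ℝ} (hp : 0 ≤ p) (a : ℝ) :
    ∫ z, |a + z| ^ p ∂gaussianReal 0 1 ≤ absMoment p + a ^ 2 * rexp (a ^ 2)
      * ∫ y, |y| ^ (p + 2) * rexp (1 / 4 * y ^ 2) ∂gaussianReal 0 1 := by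
  have hmap := integral_map (μ := gaussianReal 0 1) (φ := fun x : ℝ => a + x) (by fun_prop)
    (f := fun y : ℝ => |y| ^ p) (by fun_prop)
  rw [gaussianReal_map_const_add, zero_add] at hmap
  have i1 := integrable_abs_rpow_gaussianReal hp
  have i2 : Integrable (fun y => a * (|y| ^ p * y)) (gaussianReal 0 1) :=
    (integrable_abs_rpow_mul_self hp).const_mul a
  have i3 : Integrable (fun y => a ^ 2 * rexp (a ^ 2) * (|y| ^ (p + 2) * rexp (1 / 4 * y ^ 2)))
      (gaussianReal 0 1) :=
    (integrable_abs_rpow_mul_exp_gaussianReal (by linarith) (by norm_num)).const_mul _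
  have i12 : Integrable (fun y => |y| ^ p + a * (|y| ^ p * y)) (gaussianReal 0 1) := i1.add i2
  have i123 : Integrable (fun y => |y| ^ p + a * (|y| ^ p * y)
      + a ^ 2 * rexp (a ^ 2) * (|y| ^ (p + 2) * rexp (1 / 4 * y ^ 2))) (gaussianReal 0 1) :=
    i12.add i3
  have hsum := integral_add i12 i3
  rw [integral_add i1 i2, integral_const_mul, integral_const_mul, integral_abs_rpow_mul_self,
    mul_zero, add_zero, ← absMoment_eq_integral_gaussianReal] at hsum
  rw [← hmap, ← hsum, integral_gaussianReal_eq_integral_smul one_ne_zero,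
    integral_gaussianReal_eq_integral_smul one_ne_zero]
  refine integral_mono_of_nonneg
    (ae_of_all _ fun y => mul_nonneg (gaussianPDFReal_nonneg _ _ _) (by positivity))
    (integrable_gaussianReal_iff.1 i123) (ae_of_all _ fun y => ?_)
  have hpdf : gaussianPDFReal a 1 y ≤ gaussianPDFReal 0 1 y * rexp (a * y) := by
    have : rexp (-(y - a) ^ 2 / (2 * (1 : NNReal)))
        ≤ rexp (-(y - 0) ^ 2 / (2 * (1 : NNReal))) * rexp (a * y) := by
      rw [← exp_add, exp_le_exp]
      push_cast
      nlinarith [sq_nonneg a]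
    simp only [gaussianPDFReal, mul_assoc]
    gcongr
  have hexp : rexp (a * y) ≤ 1 + a * y
      + a ^ 2 * rexp (a ^ 2) * (y ^ 2 * rexp (1 / 4 * y ^ 2)) := by
    refine (exp_le_one_add_add_sq_mul (a * y)).trans ?_
    have : rexp |a * y| ≤ rexp (a ^ 2) * rexp (1 / 4 * y ^ 2) := by
      rw [← exp_add, exp_le_exp, abs_mul]
      nlinarith [sq_nonneg (|a| - |y| / 2), sq_abs a, sq_abs y]
    calc _ ≤ 1 + a * y + (a * y) ^ 2 * (rexp (a ^ 2) * rexp (1 / 4 * y ^ 2)) := by gcongr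
      _ = _ := by ring
  have hnn := gaussianPDFReal_nonneg 0 1 y
  simp only [smul_eq_mul]
  calc gaussianPDFReal a 1 y * |y| ^ p
      ≤ gaussianPDFReal 0 1 y * (1 + a * y
        + a ^ 2 * rexp (a ^ 2) * (y ^ 2 * rexp (1 / 4 * y ^ 2))) * |y| ^ p := by
        refine mul_le_mul_of_nonneg_right (hpdf.trans ?_) (by positivity)
        gcongr
    _ = _ := by rw [← abs_rpow_mul_sq hp]; ring

open Real in
lemma integral_abs_mehler_rpow_le {p ρ : ℝ} (hp : 0 ≤ p) (hρ : |ρ| ≤ 1 / 4) (x : ℝ) :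
    ∫ z, |ρ * x + √(1 - ρ ^ 2) * z| ^ p ∂gaussianReal 0 1 ≤ absMoment p
      + 4 * ρ ^ 2 * (x ^ 2 * rexp (1 / 4 * x ^ 2))
      * ∫ y, |y| ^ (p + 2) * rexp (1 / 4 * y ^ 2) ∂gaussianReal 0 1 := by
  have hρ2 : ρ ^ 2 ≤ 1 / 16 := by
    rw [← sq_abs]; nlinarith [abs_nonneg ρ]
  set σ := √(1 - ρ ^ 2) with hσ
  have hσ2 : σ ^ 2 = 1 - ρ ^ 2 := sq_sqrt (by linarith)
  have hσ0 : 0 < σ := sqrt_pos.2 (by linarith)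
  have hσ1 : σ ≤ 1 := by
    nlinarith [sq_nonneg ρ]
  have hK : 0 ≤ ∫ y, |y| ^ (p + 2) * rexp (1 / 4 * y ^ 2) ∂gaussianReal 0 1 :=
    integral_nonneg fun y => by positivity
  have e : ∀ z, |ρ * x + σ * z| ^ p = σ ^ p * |ρ * x / σ + z| ^ p := fun z => by
    rw [← mul_rpow hσ0.le (abs_nonneg _), ← abs_of_pos hσ0, ← abs_mul, abs_of_pos hσ0]
    congr 2
    field_simp
  simp_rw [e]
  rw [integral_const_mul]
  have hI : 0 ≤ ∫ z, |ρ * x / σ + z| ^ p ∂gaussianReal 0 1 :=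
    integral_nonneg fun y => by positivity
  refine (mul_le_of_le_one_left hI (rpow_le_one hσ0.le hσ1 hp)).trans
    ((integral_abs_add_rpow_le hp _).trans ?_)
  have ha : (ρ * x / σ) ^ 2 ≤ 4 * ρ ^ 2 * x ^ 2 := by
    rw [div_pow, div_le_iff₀ (by positivity), hσ2]
    nlinarith [mul_nonneg (sq_nonneg ρ) (sq_nonneg x)]
  have ha' : (ρ * x / σ) ^ 2 ≤ 1 / 4 * x ^ 2 := by nlinarith [sq_nonneg x]
  have := exp_le_exp.2 ha'
  rw [← mul_assoc (4 * ρ ^ 2)]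
  gcongr

open Real in
lemma gaussCorr_abs_rpow_le {p : ℝ} (hp : 0 ≤ p) {ρ : ℝ} (hρ : |ρ| ≤ 1 / 4)
    (hf : MemLp (fun x : ℝ => |x| ^ p) 2 (gaussianReal 0 1)) :
    gaussCorr (fun x => |x| ^ p) ρ ≤ absMoment p ^ 2
      + 4 * (∫ y, |y| ^ (p + 2) * rexp (1 / 4 * y ^ 2) ∂gaussianReal 0 1) ^ 2 * ρ ^ 2 := by
  set K := ∫ y, |y| ^ (p + 2) * rexp (1 / 4 * y ^ 2) ∂gaussianReal 0 1 with hK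
  have hρ2 : ρ ^ 2 ≤ 1 := by
    rw [← sq_abs]; nlinarith [abs_nonneg ρ]
  rw [gaussCorr_eq_integral_mul hρ2 hf]
  have i1 : Integrable (fun x => absMoment p * |x| ^ p) (gaussianReal 0 1) :=
    (integrable_abs_rpow_gaussianReal hp).const_mul _
  have i2 : Integrable (fun x => 4 * ρ ^ 2 * K * (|x| ^ (p + 2) * rexp (1 / 4 * x ^ 2)))
      (gaussianReal 0 1) :=
    (integrable_abs_rpow_mul_exp_gaussianReal (by linarith) (by norm_num)).const_mul _
  have hsum := integral_add i1 i2
  rw [integral_const_mul, integral_const_mul, ← absMoment_eq_integral_gaussianReal, ← hK] at hsum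
  calc _ ≤ ∫ x, absMoment p * |x| ^ p + 4 * ρ ^ 2 * K * (|x| ^ (p + 2) * rexp (1 / 4 * x ^ 2))
        ∂gaussianReal 0 1 := by
        refine integral_mono_of_nonneg (ae_of_all _ fun x => mul_nonneg (by positivity)
          (integral_nonneg fun z => by positivity)) (i1.add i2) (ae_of_all _ fun x => ?_)
        refine (mul_le_mul_of_nonneg_left (integral_abs_mehler_rpow_le hp hρ x)
          (by positivity)).trans_eq ?_
        simp only
        rw [← abs_rpow_mul_sq hp]
        ring
    _ = _ := by rw [hsum]; ring

lemma memLp_abs_rpow_gaussianReal {p : ℝ} (hp : 0 ≤ p) :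
    MemLp (fun x : ℝ => |x| ^ p) 2 (gaussianReal 0 1) := by
  rw [memLp_two_iff_integrable_sq (by fun_prop)]
  refine (integrable_abs_rpow_gaussianReal (q := 2 * p) (by linarith)).congr
    (ae_of_all _ fun x => ?_)
  simp only
  rw [mul_comm, Real.rpow_mul (abs_nonneg x)]
  norm_num

lemma absMoment_two_mul (p : ℝ) :
    absMoment (2 * p) = ∫ x, (|x| ^ p) ^ 2 ∂gaussianReal 0 1 := by
  rw [absMoment_eq_integral_gaussianReal]
  congr 1 with x
  rw [mul_comm, Real.rpow_mul (abs_nonneg x)]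
  norm_num

lemma gaussCorr_sub_const {f : ℝ → ℝ} {ρ : ℝ} (hρ : ρ ^ 2 ≤ 1)
    (hf2 : MemLp f 2 (gaussianReal 0 1)) :
    gaussCorr (fun x => f x - ∫ y, f y ∂gaussianReal 0 1) ρ
      = gaussCorr f ρ - (∫ y, f y ∂gaussianReal 0 1) ^ 2 := by
  set c := ∫ y, f y ∂gaussianReal 0 1 with hc
  have h := isStdGaussianPair_prod hρ
  have hU : Measurable fun w : ℝ × ℝ => w.1 := measurable_fst
  have hV : Measurable fun w : ℝ × ℝ => ρ * w.1 + √(1 - ρ ^ 2) * w.2 := by fun_prop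
  have i0 := h.integrable_mul hU hV hf2
  have i1 := ((memLp_comp_of_map_eq_gaussianReal hU hf2 h.map_fst).integrable
    one_le_two).const_mul c
  have i2 := ((memLp_comp_of_map_eq_gaussianReal hV hf2 h.map_snd).integrable
    one_le_two).const_mul c
  have m1 := integral_map (f := f) hU.aemeasurable (by rw [h.map_fst]; exact hf2.1)
  have m2 := integral_map (f := f) hV.aemeasurable (by rw [h.map_snd]; exact hf2.1)
  rw [h.map_fst, ← hc] at m1
  rw [h.map_snd, ← hc] at m2
  have i01 : Integrable (fun w : ℝ × ℝ => f w.1 * f (ρ * w.1 + √(1 - ρ ^ 2) * w.2) - c * f w.1)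
    ((gaussianReal 0 1).prod (gaussianReal 0 1)) := i0.sub i1
  have i012 : Integrable (fun w : ℝ × ℝ => f w.1 * f (ρ * w.1 + √(1 - ρ ^ 2) * w.2) - c * f w.1
      - c * f (ρ * w.1 + √(1 - ρ ^ 2) * w.2))
    ((gaussianReal 0 1).prod (gaussianReal 0 1)) := i01.sub i2
  have e : ∀ w : ℝ × ℝ, (f w.1 - c) * (f (ρ * w.1 + √(1 - ρ ^ 2) * w.2) - c)
      = f w.1 * f (ρ * w.1 + √(1 - ρ ^ 2) * w.2) - c * f w.1
        - c * f (ρ * w.1 + √(1 - ρ ^ 2) * w.2) + c ^ 2 := fun w => by ring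
  simp only [gaussCorr, e]
  rw [integral_add i012 (integrable_const _), integral_sub i01 i2, integral_sub i0 i1,
    integral_const_mul, integral_const_mul, ← m1, ← m2]
  simp
  ring

/-- The covariance of `|U|^p` and `|V|^p` is at most `ρ²` times the variance. -/
lemma gaussCorr_centered_abs_rpow_le {p ρ : ℝ} (hp : 0 ≤ p) (hρ : ρ ^ 2 ≤ 1) :
    gaussCorr (fun x => |x| ^ p - absMoment p) ρ
      ≤ (absMoment (2 * p) - absMoment p ^ 2) * ρ ^ 2 := by
  have hf2 := memLp_abs_rpow_gaussianReal hp
  have hf : Measurable fun x : ℝ => |x| ^ p := by fun_prop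
  have hg2 : MemLp (fun x : ℝ => |x| ^ p - absMoment p) 2 (gaussianReal 0 1) :=
    hf2.sub (memLp_const _)
  have hg : Measurable fun x : ℝ => |x| ^ p - absMoment p := by fun_prop
  have hsub : ∀ ρ : ℝ, ρ ^ 2 ≤ 1 → gaussCorr (fun x => |x| ^ p - absMoment p) ρ
      = gaussCorr (fun x => |x| ^ p) ρ - absMoment p ^ 2 := fun ρ hρ => by
    rw [absMoment_eq_integral_gaussianReal]
    exact gaussCorr_sub_const hρ hf2
  have h1 : gaussCorr (fun x => |x| ^ p - absMoment p) 1
      = absMoment (2 * p) - absMoment p ^ 2 := by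
    rw [hsub 1 (by norm_num), gaussCorr_one, absMoment_two_mul]
  have hA := gaussCorr_one (g := fun x => |x| ^ p - absMoment p)
  rw [h1] at hA
  refine le_mul_sq_of_sq_le (C := 4 * (∫ y, |y| ^ (p + 2) * Real.exp (1 / 4 * y ^ 2)
    ∂gaussianReal 0 1) ^ 2) ?_ h1 (fun ρ hρ => ?_) (fun ρ hρ => ?_) hρ
  · rw [hA]
    exact integral_nonneg fun x => sq_nonneg _
  · rw [hA]
    exact sq_gaussCorr_le hρ hg hg2
  · have hρ2 : ρ ^ 2 ≤ 1 := by
      rw [← sq_abs]; nlinarith [abs_nonneg ρ]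
    rw [hsub ρ hρ2, sub_le_iff_le_add']
    exact gaussCorr_abs_rpow_le hp hρ hf2

lemma memLp_two_of_map_eq_gaussianReal {Ω : Type*} [MeasurableSpace Ω] {P : Measure Ω}
    {X : Ω → ℝ} {s : NNReal} (hX : Measurable X) (h : P.map X = gaussianReal 0 s) :
    MemLp X 2 P :=
  (memLp_id_gaussianReal (μ := 0) (v := s) 2).comp_measurePreserving ⟨hX, h⟩

lemma integral_sq_of_map_eq_gaussianReal_s7 {Ω : Type*} [MeasurableSpace Ω] {P : Measure Ω}
    {X : Ω → ℝ} {s : NNReal} (hX : Measurable X) (h : P.map X = gaussianReal 0 s) :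
    ∫ ω, X ω ^ 2 ∂P = s := by
  have h1 := integral_map (μ := P) (f := fun x : ℝ => x ^ 2) hX.aemeasurable (by fun_prop)
  have h2 := variance_fun_id_gaussianReal (μ := 0) (v := s)
  rw [variance_eq_integral (by fun_prop)] at h2
  simp only [integral_id_gaussianReal, sub_zero] at h2
  rw [← h1, h, h2]

lemma isStdGaussianPair_of_forall_map_eq {Ω : Type*} [MeasurableSpace Ω] {P : Measure Ω}
    {U V : Ω → ℝ} (hU : Measurable U) (hV : Measurable V)
    (h : ∀ α β : ℝ, ∃ s : NNReal, P.map (fun ω => α * U ω + β * V ω) = gaussianReal 0 s)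
    (hU2 : MemLp U 2 P) (hV2 : MemLp V 2 P)
    (hU1 : ∫ ω, U ω ^ 2 ∂P = 1) (hV1 : ∫ ω, V ω ^ 2 ∂P = 1) :
    IsStdGaussianPair P U V (∫ ω, U ω * V ω ∂P) := by
  intro α β
  obtain ⟨s, hs⟩ := h α β
  rw [hs]
  have h1 := integral_sq_of_map_eq_gaussianReal_s7 (by fun_prop) hs
  have i1 : Integrable (fun ω => α ^ 2 * U ω ^ 2) P := hU2.integrable_sq.const_mul _
  have i2 : Integrable (fun ω => 2 * α * β * (U ω * V ω)) P := (hU2.integrable_mul hV2).const_mul _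
  have i3 : Integrable (fun ω => β ^ 2 * V ω ^ 2) P := hV2.integrable_sq.const_mul _
  have i12 : Integrable (fun ω => α ^ 2 * U ω ^ 2 + 2 * α * β * (U ω * V ω)) P := i1.add i2
  have e : ∀ ω, (α * U ω + β * V ω) ^ 2
      = α ^ 2 * U ω ^ 2 + 2 * α * β * (U ω * V ω) + β ^ 2 * V ω ^ 2 := fun ω => by ring
  simp only [e] at h1
  rw [integral_add i12 i3, integral_add i1 i2, integral_const_mul, integral_const_mul,
    integral_const_mul, hU1, hV1, mul_one, mul_one] at h1
  rw [h1, Real.toNNReal_coe]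

theorem stmt_7 {Ω : Type*} [MeasurableSpace Ω] (P : Measure Ω) [IsProbabilityMeasure P]
    (N : ℕ) (hN : 1 ≤ N) (v : Fin N → Ω → ℝ) (hv : ∀ k, Measurable (v k))
    -- (v_1, …, v_N) is a centered Gaussian vector:
    (hGauss : ∀ α : Fin N → ℝ, ∃ var : NNReal,
      Measure.map (fun ω => ∑ k, α k * v k ω) P = gaussianReal 0 var)
    (hvar : ∀ k, ∫ ω, (v k ω) ^ 2 ∂P = 1)
    (p : ℝ) (hp : 1 ≤ p) :
    ∫ ω, (∑ k, (|v k ω| ^ p - absMoment p)) ^ 2 ∂P ≤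
      (absMoment (2 * p) - (absMoment p) ^ 2) *
        ∑ k, ∑ k', (∫ ω, v k ω * v k' ω ∂P) ^ 2 := by
  have hp0 : 0 ≤ p := zero_le_one.trans hp
  have hmem : ∀ k, MemLp (v k) 2 P := fun k => by
    obtain ⟨s, hs⟩ := hGauss (Pi.single k 1)
    simp only [Pi.single_apply, ite_mul, one_mul, zero_mul, Finset.sum_ite_eq', Finset.mem_univ,
      if_true] at hs
    exact memLp_two_of_map_eq_gaussianReal (hv k) hs
  have hpair : ∀ k k', IsStdGaussianPair P (v k) (v k') (∫ ω, v k ω * v k' ω ∂P) := fun k k' => by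
    refine isStdGaussianPair_of_forall_map_eq (hv k) (hv k') (fun α β => ?_) (hmem k) (hmem k')
      (hvar k) (hvar k')
    obtain ⟨s, hs⟩ := hGauss (Pi.single k α + Pi.single k' β)
    refine ⟨s, ?_⟩
    simpa [Pi.single_apply, add_mul, Finset.sum_add_distrib] using hs
  have hρ : ∀ k k', (∫ ω, v k ω * v k' ω ∂P) ^ 2 ≤ 1 := fun k k' => by
    simpa [hvar] using sq_integral_mul_le (hmem k) (hmem k')
  have hg : Measurable fun x : ℝ => |x| ^ p - absMoment p := by fun_prop
  have hg2 : MemLp (fun x : ℝ => |x| ^ p - absMoment p) 2 (gaussianReal 0 1) :=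
    (memLp_abs_rpow_gaussianReal hp0).sub (memLp_const _)
  have hint : ∀ k k', Integrable
      (fun ω => (|v k ω| ^ p - absMoment p) * (|v k' ω| ^ p - absMoment p)) P := fun k k' =>
    (hpair k k').integrable_mul (hv k) (hv k') hg2
  simp_rw [sq (∑ k, _), Finset.sum_mul_sum]
  rw [integral_finsetSum _ fun k _ => integrable_finsetSum _ fun k' _ => hint k k',
    Finset.mul_sum]
  refine Finset.sum_le_sum fun k _ => ?_
  rw [integral_finsetSum _ fun k' _ => hint k k', Finset.mul_sum]
  refine Finset.sum_le_sum fun k' _ => ?_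
  refine ((hpair k k').integral_mul_eq_gaussCorr (hv k) (hv k') (hρ k k') hg).trans_le ?_
  exact gaussCorr_centered_abs_rpow_le hp0 (hρ k k')
end

section
/- Fix t > 0. For every j ≥ 1 and all k, k' ∈ {1,…,2^j} with k ≠ k', there exists a constant κ_{j,k,k'} ∈ (0,4) such that |q_{j,k,k'}| ≤ (3θ/(16√π)) · 1/|2(k−k') − 2 + κ_{j,k,k'}|³, where θ = ∫_0^∞ (e^{−1/(4s)}/s^{5/2}) [1 + 1/s + 1/(12 s²)] ds. -/
open MeasureTheory Real Finset

/-- `F t u = ∫_0^t (1/(2√(π r))) e^{−u²/(4r)} dr`, the covariance of the mild solution of the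
stochastic heat equation at time `t` between spatial points at distance `u`. -/
noncomputable def F (t u : ℝ) : ℝ :=
  ∫ r in (0:ℝ)..t, (1 / (2 * Real.sqrt (Real.pi * r))) * Real.exp (-u ^ 2 / (4 * r))

/-- `q t j k k' = E[z_{jk} z_{jk'}]` for the Schauder coefficients of the solution in space. -/
noncomputable def q (t : ℝ) (j k k' : ℕ) : ℝ :=
  4 * 2 ^ j * ∑ m ∈ Finset.range 3, ∑ m' ∈ Finset.range 3,
    c m * c m' * F t (a j k m - a j k' m')

/-- `θ = ∫_0^∞ (e^{−1/(4s)}/s^{5/2}) [1 + 1/s + 1/(12 s²)] ds`. -/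
noncomputable def θ : ℝ :=
  ∫ s in Set.Ioi (0:ℝ),
    (Real.exp (-(1 / (4 * s))) / s ^ ((5 : ℝ) / 2)) * (1 + 1 / s + 1 / (12 * s ^ 2))

/-- Iterated mean value inequality: an `n`-th forward difference is at most `hⁿ` times the supremum
of the `n`-th derivative. -/
theorem abs_fwdDiff_iter_le {h M : ℝ} (hh : 0 ≤ h) (n : ℕ) (g : ℕ → ℝ → ℝ) (x : ℝ)
    (hg : ∀ i < n, ∀ y, HasDerivAt (g i) (g (i + 1) y) y)
    (hM : ∀ y ∈ Set.Icc x (x + n * h), |g n y| ≤ M) :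
    |(fwdDiff h)^[n] (g 0) x| ≤ h ^ n * M := by
  induction n generalizing g M with
  | zero => simpa using hM x (by simp)
  | succ n ih =>
    have hD : ∀ i < n, ∀ y, HasDerivAt (fwdDiff h (g i)) (fwdDiff h (g (i + 1)) y) y := by
      intro i hi y
      exact ((hg i (by omega) (y + h)).comp_add_const y h).sub (hg i (by omega) y)
    have hb : ∀ y ∈ Set.Icc x (x + n * h), |fwdDiff h (g n) y| ≤ h * M := by
      intro y hy
      have hmv := Convex.norm_image_sub_le_of_norm_hasDerivWithin_le (f := g n) (f' := g (n + 1))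
        (s := Set.Icc y (y + h)) (x := y) (y := y + h) (C := M)
        (fun z _ => (hg n (by omega) z).hasDerivWithinAt)
        (fun z hz => hM z ⟨hy.1.trans hz.1, by push_cast; linarith [hz.2, hy.2]⟩)
        (convex_Icc _ _) (by simp [hh]) (by simp [hh])
      simpa [fwdDiff, abs_of_nonneg hh, mul_comm] using hmv
    have := ih (fun i => fwdDiff h (g i)) hD hb
    rw [Function.iterate_succ_apply]
    calc _ ≤ _ := this
      _ = _ := by ring

theorem fwdDiff_four (h : ℝ) (f : ℝ → ℝ) (x : ℝ) :
    (fwdDiff h)^[4] f (x - 2 * h) =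
      f (x - 2 * h) - 4 * f (x - h) + 6 * f x - 4 * f (x + h) + f (x + 2 * h) := by
  simp only [Function.iterate_succ_apply, Function.iterate_zero_apply, fwdDiff]
  ring_nf

theorem integral_rpow_mul_exp_neg_div {a b : ℝ} (ha : 0 < a) (hb : 0 < b) :
    ∫ s in Set.Ioi (0 : ℝ), s ^ (-a - 1) * Real.exp (-(b / s)) = (1 / b) ^ a * Real.Gamma a := by
  rw [← Real.integral_rpow_mul_exp_neg_mul_Ioi ha hb,
    ← integral_comp_rpow_Ioi (fun y : ℝ => y ^ (a - 1) * Real.exp (-(b * y)))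
      (p := -1) (by norm_num)]
  refine setIntegral_congr_fun measurableSet_Ioi fun s hs => ?_
  have hs : 0 < s := hs
  simp only [smul_eq_mul]
  rw [← Real.rpow_mul hs.le, Real.rpow_neg_one, ← div_eq_mul_inv]
  rw [abs_neg, abs_one, one_mul, ← mul_assoc, ← Real.rpow_add hs]
  ring_nf

theorem integrableOn_rpow_mul_exp_neg_div {a b : ℝ} (ha : 0 < a) (hb : 0 < b) :
    IntegrableOn (fun s : ℝ => s ^ (-a - 1) * Real.exp (-(b / s))) (Set.Ioi 0) := by
  by_contra hn
  have h := integral_rpow_mul_exp_neg_div ha hb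
  rw [integral_undef hn] at h
  have := Real.Gamma_pos_of_pos ha
  have : 0 < (1 / b) ^ a * Real.Gamma a := by positivity
  linarith

theorem Gamma_three_halves : Real.Gamma (3 / 2) = √π / 2 := by
  rw [show (3 / 2 : ℝ) = 1 / 2 + 1 by norm_num, Real.Gamma_add_one (by norm_num),
    Real.Gamma_one_half_eq]
  ring

theorem Gamma_five_halves : Real.Gamma (5 / 2) = 3 * √π / 4 := by
  rw [show (5 / 2 : ℝ) = 3 / 2 + 1 by norm_num, Real.Gamma_add_one (by norm_num),
    Gamma_three_halves]
  ring

theorem Gamma_seven_halves : Real.Gamma (7 / 2) = 15 * √π / 8 := by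
  rw [show (7 / 2 : ℝ) = 5 / 2 + 1 by norm_num, Real.Gamma_add_one (by norm_num),
    Gamma_five_halves]
  ring

theorem θ_eq : θ = 48 * √π := by
  have i3 := integrableOn_rpow_mul_exp_neg_div (a := 3 / 2) (b := 1 / 4) (by norm_num) (by norm_num)
  have i5 := integrableOn_rpow_mul_exp_neg_div (a := 5 / 2) (b := 1 / 4) (by norm_num) (by norm_num)
  have i7 := integrableOn_rpow_mul_exp_neg_div (a := 7 / 2) (b := 1 / 4) (by norm_num) (by norm_num)
  have v3 := integral_rpow_mul_exp_neg_div (a := 3 / 2) (b := 1 / 4) (by norm_num) (by norm_num)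
  have v5 := integral_rpow_mul_exp_neg_div (a := 5 / 2) (b := 1 / 4) (by norm_num) (by norm_num)
  have v7 := integral_rpow_mul_exp_neg_div (a := 7 / 2) (b := 1 / 4) (by norm_num) (by norm_num)
  have key : θ = ∫ s in Set.Ioi (0 : ℝ),
      ((s ^ (-(3 / 2 : ℝ) - 1) * Real.exp (-(1 / 4 / s)) +
        s ^ (-(5 / 2 : ℝ) - 1) * Real.exp (-(1 / 4 / s))) +
        1 / 12 * (s ^ (-(7 / 2 : ℝ) - 1) * Real.exp (-(1 / 4 / s)))) := by
    refine setIntegral_congr_fun measurableSet_Ioi fun s hs => ?_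
    have hs : 0 < s := hs
    have h5 : s ^ (-(5 / 2 : ℝ) - 1) = s ^ (-(5 / 2 : ℝ)) / s := Real.rpow_sub_one hs.ne' _
    have h7 : s ^ (-(7 / 2 : ℝ) - 1) = s ^ (-(5 / 2 : ℝ)) / s / s := by
      rw [← h5, ← Real.rpow_sub_one hs.ne']
      norm_num
    have h3 : s ^ (-(3 / 2 : ℝ) - 1) = s ^ (-(5 / 2 : ℝ)) := by norm_num
    have h0 : 0 < s ^ (5 / 2 : ℝ) := by positivity
    simp only [h3, h5, h7, Real.rpow_neg hs.le, div_div]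
    field_simp
  have i35 : IntegrableOn (fun s : ℝ => s ^ (-(3 / 2 : ℝ) - 1) * Real.exp (-(1 / 4 / s)) +
      s ^ (-(5 / 2 : ℝ) - 1) * Real.exp (-(1 / 4 / s))) (Set.Ioi 0) := i3.add i5
  rw [key, integral_add i35 (i7.const_mul _), integral_add i3 i5, integral_const_mul,
    v3, v5, v7, Gamma_three_halves, Gamma_five_halves, Gamma_seven_halves]
  norm_num
  ring

theorem F_neg (t u : ℝ) : F t (-u) = F t u := by simp [F]

theorem intervalIntegrable_F {t : ℝ} (ht : 0 < t) (u : ℝ) :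
    IntervalIntegrable (fun r : ℝ => (1 / (2 * √(π * r))) * Real.exp (-u ^ 2 / (4 * r)))
      volume 0 t := by
  have h := intervalIntegral.intervalIntegrable_rpow' (a := 0) (b := t)
    (show (-1 : ℝ) < -(1 / 2) by norm_num)
  rw [intervalIntegrable_iff_integrableOn_Ioc_of_le ht.le] at h ⊢
  refine Integrable.mono' h (by fun_prop) ?_
  filter_upwards [ae_restrict_mem measurableSet_Ioc] with r hr
  have hr0 : 0 < r := hr.1
  have h1 : Real.exp (-u ^ 2 / (4 * r)) ≤ 1 := by
    rw [Real.exp_le_one_iff, neg_div]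
    exact neg_nonpos.2 (by positivity)
  rw [Real.norm_of_nonneg (by positivity), Real.rpow_neg hr0.le, ← Real.sqrt_eq_rpow, ← one_div]
  have h2 : √r ≤ 2 * √(π * r) := by
    have : √r ≤ √(π * r) := Real.sqrt_le_sqrt (by nlinarith [Real.pi_gt_three])
    linarith [Real.sqrt_nonneg (π * r)]
  calc _ ≤ 1 / (2 * √(π * r)) * 1 := by gcongr
    _ ≤ _ := by rw [mul_one]; gcongr

/-- Successive derivatives in `u` of `exp (-v u² / 2)`, correct for `i ≤ 4`. -/
noncomputable def gaussDeriv (v : ℝ) (i : ℕ) (u : ℝ) : ℝ :=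
  (match i with
    | 0 => 1
    | 1 => -(v * u)
    | 2 => v ^ 2 * u ^ 2 - v
    | 3 => 3 * v ^ 2 * u - v ^ 3 * u ^ 3
    | _ => v ^ 4 * u ^ 4 - 6 * v ^ 3 * u ^ 2 + 3 * v ^ 2) * Real.exp (-(v * u ^ 2 / 2))

theorem hasDerivAt_gaussDeriv (v : ℝ) (i : ℕ) (hi : i < 4) (u : ℝ) :
    HasDerivAt (gaussDeriv v i) (gaussDeriv v (i + 1) u) u := by
  have hE : HasDerivAt (fun u : ℝ => Real.exp (-(v * u ^ 2 / 2)))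
      (Real.exp (-(v * u ^ 2 / 2)) * (-(v * u))) u := by
    have := ((((hasDerivAt_pow 2 u).const_mul v).div_const 2).fun_neg).exp
    refine this.congr_deriv ?_
    push_cast
    ring
  have hp := fun n : ℕ => hasDerivAt_pow n u
  interval_cases i
  · refine ((hasDerivAt_const u (1 : ℝ)).mul hE).congr_deriv ?_
    simp only [gaussDeriv]
    ring
  · refine ((((hasDerivAt_id u).const_mul v).fun_neg).mul hE).congr_deriv ?_
    simp only [gaussDeriv, id]
    ring
  · refine ((((hp 2).const_mul (v ^ 2)).sub_const v).mul hE).congr_deriv ?_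
    simp only [gaussDeriv]
    push_cast
    ring
  · refine ((((hasDerivAt_id u).const_mul (3 * v ^ 2)).fun_sub
      ((hp 3).const_mul (v ^ 3))).mul hE).congr_deriv ?_
    simp only [gaussDeriv, id]
    push_cast
    ring

theorem abs_quadratic_le_exp {y : ℝ} (hy : 0 ≤ y) :
    |4 * y ^ 2 - 6 * y + 3 / 4| ≤ 2 * Real.exp y := by
  have h := Real.sum_le_exp_of_nonneg hy 4
  simp [Finset.sum_range_succ, Nat.factorial] at h
  have hy3 : 0 ≤ y ^ 3 := by positivity
  rw [abs_le]
  constructor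
  · nlinarith [sq_nonneg (y - 1)]
  · nlinarith [mul_nonneg hy (sq_nonneg (y - 9 / 2))]

theorem abs_gaussDeriv_four_le {r A u : ℝ} (hr : 0 < r) (hA : 0 < A) (hu : A ≤ u) :
    |gaussDeriv (1 / (2 * r)) 4 u| ≤ 2 / r ^ 2 * Real.exp (-((A / 3) ^ 2 / r)) := by
  have hy : 0 ≤ u ^ 2 / (8 * r) := by positivity
  have h := abs_quadratic_le_exp hy
  have hpoly : gaussDeriv (1 / (2 * r)) 4 u = (4 * (u ^ 2 / (8 * r)) ^ 2 - 6 * (u ^ 2 / (8 * r)) +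
      3 / 4) * (1 / r ^ 2) * Real.exp (-(2 * (u ^ 2 / (8 * r)))) := by
    simp only [gaussDeriv]
    congr 1
    · field_simp
      ring
    · congr 1
      field_simp
      ring
  have hE : Real.exp (-(u ^ 2 / (8 * r))) ≤ Real.exp (-((A / 3) ^ 2 / r)) := by
    rw [Real.exp_le_exp, neg_le_neg_iff, div_le_div_iff₀ (by positivity) (by positivity)]
    have : A ^ 2 ≤ u ^ 2 := by gcongr
    nlinarith [sq_nonneg u]
  rw [hpoly, abs_mul, abs_mul, abs_of_nonneg (show 0 ≤ 1 / r ^ 2 by positivity), Real.abs_exp]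
  calc _ ≤ 2 * Real.exp (u ^ 2 / (8 * r)) * (1 / r ^ 2) * Real.exp (-(2 * (u ^ 2 / (8 * r)))) := by
        gcongr
    _ = 2 / r ^ 2 * (Real.exp (u ^ 2 / (8 * r)) * Real.exp (-(2 * (u ^ 2 / (8 * r))))) := by ring
    _ = 2 / r ^ 2 * Real.exp (-(u ^ 2 / (8 * r))) := by
        rw [← Real.exp_add]
        ring_nf
    _ ≤ _ := by gcongr

theorem abs_fwdDiff_F_le {t h d : ℝ} (ht : 0 < t) (hh : 0 ≤ h) (hd : 2 * h < d) :
    |F t (d - 2 * h) - 4 * F t (d - h) + 6 * F t d - 4 * F t (d + h) + F t (d + 2 * h)| ≤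
      27 / 2 * h ^ 4 / (d - 2 * h) ^ 3 := by
  have hA : 0 < d - 2 * h := by linarith
  have hb : 0 < ((d - 2 * h) / 3) ^ 2 := by positivity
  have hi := integrableOn_rpow_mul_exp_neg_div (a := 3 / 2) (by norm_num) hb
  have hv := integral_rpow_mul_exp_neg_div (a := 3 / 2) (by norm_num) hb
  have i := intervalIntegrable_F ht
  have hsum : F t (d - 2 * h) - 4 * F t (d - h) + 6 * F t d - 4 * F t (d + h) + F t (d + 2 * h) =
      ∫ r in (0 : ℝ)..t, 1 / (2 * √(π * r)) *
        (fwdDiff h)^[4] (gaussDeriv (1 / (2 * r)) 0) (d - 2 * h) := by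
    simp only [F]
    rw [← intervalIntegral.integral_const_mul, ← intervalIntegral.integral_const_mul,
      ← intervalIntegral.integral_const_mul,
      ← intervalIntegral.integral_sub (i _) ((i _).const_mul _),
      ← intervalIntegral.integral_add ((i _).sub ((i _).const_mul _)) ((i _).const_mul _),
      ← intervalIntegral.integral_sub (((i _).sub ((i _).const_mul _)).add ((i _).const_mul _))
        ((i _).const_mul _),
      ← intervalIntegral.integral_add ((((i _).sub ((i _).const_mul _)).add
        ((i _).const_mul _)).sub ((i _).const_mul _)) (i _)]
    refine intervalIntegral.integral_congr fun r _ => ?_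
    have hg (u : ℝ) : gaussDeriv (1 / (2 * r)) 0 u = Real.exp (-u ^ 2 / (4 * r)) := by
      simp only [gaussDeriv, one_mul]
      congr 1
      ring
    simp only [fwdDiff_four, hg]
    ring
  rw [hsum, ← Real.norm_eq_abs]
  set b := ((d - 2 * h) / 3) ^ 2 with hbdef
  have hle : ‖∫ r in (0 : ℝ)..t, 1 / (2 * √(π * r)) *
        (fwdDiff h)^[4] (gaussDeriv (1 / (2 * r)) 0) (d - 2 * h)‖ ≤
      ∫ r in (0 : ℝ)..t, h ^ 4 / √π * (r ^ (-(3 / 2 : ℝ) - 1) * Real.exp (-(b / r))) := by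
    refine intervalIntegral.norm_integral_le_of_norm_le ht.le ?_ ?_
    · refine Filter.Eventually.of_forall fun r hr => ?_
      have hr0 : 0 < r := hr.1
      have hbd := abs_fwdDiff_iter_le hh 4 (gaussDeriv (1 / (2 * r))) (d - 2 * h)
        (hasDerivAt_gaussDeriv _) (fun y hy => abs_gaussDeriv_four_le hr0 hA hy.1)
      have hpow : r ^ (-(3 / 2 : ℝ) - 1) = 1 / (√r * r ^ 2) := by
        rw [show (-(3 / 2 : ℝ) - 1) = -(1 / 2 + (2 : ℕ)) by norm_num, Real.rpow_neg hr0.le,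
          Real.rpow_add_natCast hr0.ne', ← Real.sqrt_eq_rpow, one_div]
      rw [norm_mul, Real.norm_of_nonneg (by positivity), Real.norm_eq_abs, hpow,
        Real.sqrt_mul pi_pos.le]
      calc _ ≤ 1 / (2 * (√π * √r)) * (h ^ 4 * (2 / r ^ 2 * Real.exp (-(b / r)))) := by gcongr
        _ = _ := by
          have := Real.sqrt_pos.2 hr0
          have := Real.sqrt_pos.2 pi_pos
          field_simp
    · rw [intervalIntegrable_iff_integrableOn_Ioc_of_le ht.le]
      exact (hi.mono_set Set.Ioc_subset_Ioi_self).const_mul _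
  refine hle.trans ?_
  rw [intervalIntegral.integral_const_mul, intervalIntegral.integral_of_le ht.le]
  have hmono : ∫ r in Set.Ioc (0 : ℝ) t, r ^ (-(3 / 2 : ℝ) - 1) * Real.exp (-(b / r)) ≤
      ∫ r in Set.Ioi (0 : ℝ), r ^ (-(3 / 2 : ℝ) - 1) * Real.exp (-(b / r)) := by
    refine setIntegral_mono_set hi ?_ Set.Ioc_subset_Ioi_self.eventuallyLE
    filter_upwards [ae_restrict_mem measurableSet_Ioi] with r hr
    have hr0 : 0 < r := hr
    simp only [Pi.zero_apply]
    positivity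
  have hbpow : (1 / b) ^ (3 / 2 : ℝ) = (3 / (d - 2 * h)) ^ 3 := by
    rw [hbdef, show 1 / ((d - 2 * h) / 3) ^ 2 = (3 / (d - 2 * h)) ^ (2 : ℝ) by
      rw [Real.rpow_two]; field_simp, ← Real.rpow_mul (by positivity), ← Real.rpow_natCast]
    norm_num
  rw [hv, hbpow, Gamma_three_halves] at hmono
  calc _ ≤ h ^ 4 / √π * ((3 / (d - 2 * h)) ^ 3 * (√π / 2)) := by gcongr
    _ = _ := by
      have := Real.sqrt_pos.2 pi_pos
      field_simp
      norm_num

theorem q_eq (t : ℝ) (j k k' : ℕ) (h d : ℝ) (hh : h = 1 / 2 ^ (j + 1))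
    (hd : d = 2 * ((k : ℝ) - k') * h) :
    q t j k k' = 2 ^ j *
      (F t (d - 2 * h) - 4 * F t (d - h) + 6 * F t d - 4 * F t (d + h) + F t (d + 2 * h)) := by
  have ha (m m' : ℕ) : a j k m - a j k' m' = d + ((if m' = 0 then 1 else if m' = 1 then 0 else 2) -
      (if m = 0 then 1 else if m = 1 then 0 else 2)) * h := by
    rw [hd, hh]
    simp only [a]
    ring
  simp only [q, Finset.sum_range_succ, Finset.sum_range_zero, ha, c]
  norm_num
  ring_nf

theorem q_symm (t : ℝ) (j k k' : ℕ) : q t j k k' = q t j k' k := by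
  rw [q_eq t j k k' _ _ rfl rfl, q_eq t j k' k _ _ rfl rfl]
  set h : ℝ := 1 / 2 ^ (j + 1)
  set d : ℝ := 2 * ((k : ℝ) - k') * h with hd
  rw [show 2 * ((k' : ℝ) - k) * h = -d by rw [hd]; ring, ← F_neg t (-d - 2 * h),
    ← F_neg t (-d - h), ← F_neg t (-d), ← F_neg t (-d + h), ← F_neg t (-d + 2 * h)]
  ring_nf

theorem abs_q_le {t : ℝ} (ht : 0 < t) {j k k' : ℕ} (hlt : k' + 2 ≤ k) :
    |q t j k k'| ≤ 27 / 4 / (2 * ((k : ℝ) - k') - 2) ^ 3 := by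
  have hN : (2 : ℝ) ≤ (k : ℝ) - k' := by
    have : ((k' + 2 : ℕ) : ℝ) ≤ k := by exact_mod_cast hlt
    push_cast at this
    linarith
  obtain ⟨h, hh⟩ : ∃ h : ℝ, h = 1 / 2 ^ (j + 1) := ⟨_, rfl⟩
  have hpos : 0 < h := by rw [hh]; positivity
  have hb := abs_fwdDiff_F_le (t := t) (h := h) (d := 2 * ((k : ℝ) - k') * h) ht hpos.le
    (by nlinarith)
  rw [q_eq t j k k' h _ hh rfl, abs_mul, abs_of_pos (show (0 : ℝ) < 2 ^ j by positivity)]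
  have h2 : (2 : ℝ) ^ j = 1 / (2 * h) := by
    rw [hh, pow_succ]
    field_simp
  have hne : 2 * ((k : ℝ) - k') - 2 ≠ 0 := by linarith
  refine (mul_le_mul_of_nonneg_left hb (by positivity)).trans_eq ?_
  rw [h2, show 2 * ((k : ℝ) - k') * h - 2 * h = (2 * ((k : ℝ) - k') - 2) * h by ring]
  generalize 2 * ((k : ℝ) - k') - 2 = M at hne
  field_simp
  norm_num

theorem exists_kappa_of_lt {t : ℝ} (ht : 0 < t) {j k k' : ℕ} (hlt : k' < k) :
    ∃ κ ∈ Set.Ioo (0 : ℝ) 4, |q t j k k'| ≤ 9 * (1 / |2 * ((k : ℝ) - k') - 2 + κ| ^ 3) := by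
  obtain rfl | h2 := Nat.eq_or_lt_of_le (Nat.succ_le_of_lt hlt)
  · set Q := |q t j k'.succ k'|
    have hQ0 : 0 ≤ Q := abs_nonneg _
    have hκ : 0 < 1 / (Q + 1) := by positivity
    have hκ1 : 1 / (Q + 1) ≤ 1 := by rw [div_le_one (by positivity)]; linarith
    refine ⟨1 / (Q + 1), ⟨hκ, by linarith⟩, ?_⟩
    have : 2 * (((k'.succ : ℕ) : ℝ) - k') - 2 + 1 / (Q + 1) = 1 / (Q + 1) := by
      push_cast
      ring
    rw [this, abs_of_pos hκ, one_div_pow, one_div_one_div]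
    nlinarith [pow_nonneg hQ0 3, pow_nonneg hQ0 2]
  · have hN : (2 : ℝ) ≤ (k : ℝ) - k' := by
      have : ((k' + 2 : ℕ) : ℝ) ≤ k := by exact_mod_cast h2
      push_cast at this
      linarith
    refine ⟨1 / 8, by norm_num, (abs_q_le ht h2).trans ?_⟩
    obtain ⟨M, hMdef⟩ : ∃ M : ℝ, M = 2 * ((k : ℝ) - k') - 2 := ⟨_, rfl⟩
    have hM : 2 ≤ M := by linarith
    rw [← hMdef, abs_of_pos (by linarith), mul_one_div,
      div_le_div_iff₀ (by positivity) (by positivity)]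
    have : (M + 1 / 8) ^ 3 ≤ (17 / 16 * M) ^ 3 := by gcongr; linarith
    nlinarith [pow_pos (show 0 < M by linarith) 3]

theorem stmt_9 (t : ℝ) (ht : 0 < t) (j k k' : ℕ) (hj : 1 ≤ j)
    (hk : k ∈ Finset.Icc 1 (2 ^ j)) (hk' : k' ∈ Finset.Icc 1 (2 ^ j)) (hne : k ≠ k') :
    ∃ κ ∈ Set.Ioo (0 : ℝ) 4,
      |q t j k k'| ≤ (3 * θ / (16 * Real.sqrt Real.pi)) *
        (1 / |2 * ((k : ℝ) - (k' : ℝ)) - 2 + κ| ^ 3) := by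
  have hθ : 3 * θ / (16 * Real.sqrt Real.pi) = 9 := by
    have := Real.sqrt_pos.2 pi_pos
    rw [θ_eq]
    field_simp
    norm_num
  rw [hθ]
  obtain hlt | hlt := Nat.lt_or_gt_of_ne hne
  · obtain ⟨κ, hκ, hle⟩ := exists_kappa_of_lt (j := j) ht hlt
    refine ⟨4 - κ, ⟨by linarith [hκ.2], by linarith [hκ.1]⟩, ?_⟩
    rw [q_symm, ← abs_neg (2 * ((k : ℝ) - k') - 2 + (4 - κ))]
    convert hle using 5
    ring
  · exact exists_kappa_of_lt ht hlt
end

section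
/- Fix t > 0. There exists a constant K > 0 such that for every j ≥ 1, Σ_{k,k'=1}^{2^j} q_{j,k,k'}² / (q_{j,k,k} · q_{j,k',k'}) ≤ K · 2^j; that is, the sum over k, k' of the squared correlation coefficients of the normalized coefficients ω_{jk} = z_{jk}/√(q_{j,k,k}) is at most K·2^j. -/
open MeasureTheory Real Finset

/-- The unnormalised error function `x ↦ ∫_0^x e^{-s²} ds`. -/
noncomputable def erfInt (x : ℝ) : ℝ := ∫ s in (0:ℝ)..x, Real.exp (-s ^ 2)

/-- The smooth part of `F t`, that is `F t u + |u| / 2`. -/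
noncomputable def smoothPart (t u : ℝ) : ℝ :=
  √t / √π * Real.exp (-u ^ 2 / (4 * t)) + u / √π * erfInt (u / (2 * √t))

lemma hasDerivAt_erfInt (x : ℝ) : HasDerivAt erfInt (Real.exp (-x ^ 2)) x := by
  have hc : Continuous fun s : ℝ => Real.exp (-s ^ 2) := by fun_prop
  exact hc.integral_hasStrictDerivAt 0 x |>.hasDerivAt

lemma erfInt_neg (x : ℝ) : erfInt (-x) = -erfInt x := by
  have h := intervalIntegral.integral_comp_neg (a := 0) (b := x)
    (fun s : ℝ => Real.exp (-s ^ 2))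
  simp only [neg_sq, neg_zero] at h
  rw [erfInt, erfInt, h, intervalIntegral.integral_symm]

lemma tendsto_erfInt_atTop : Filter.Tendsto erfInt Filter.atTop (nhds (√π / 2)) := by
  have hint : IntegrableOn (fun s : ℝ => Real.exp (-s ^ 2)) (Set.Ioi 0) := by
    simpa using (integrable_exp_neg_mul_sq one_pos).integrableOn
  have h := intervalIntegral_tendsto_integral_Ioi 0 hint Filter.tendsto_id
  have hv := integral_gaussian_Ioi 1
  simp only [neg_mul, one_mul, div_one] at hv
  rwa [hv] at h

lemma smoothPart_abs (t u : ℝ) : smoothPart t |u| = smoothPart t u := by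
  rcases abs_choice u with h | h <;> rw [h]
  simp only [smoothPart, neg_sq, neg_div, erfInt_neg]
  ring

lemma hasDerivAt_smoothPart {t : ℝ} (ht : 0 < t) (u : ℝ) :
    HasDerivAt (smoothPart t) (erfInt (u / (2 * √t)) / √π) u := by
  have hs : 0 < √t := Real.sqrt_pos.2 ht
  have hp : 0 < √π := Real.sqrt_pos.2 Real.pi_pos
  have h1 : HasDerivAt (fun u : ℝ => -u ^ 2 / (4 * t)) (-(2 * u) / (4 * t)) u := by
    simpa using ((hasDerivAt_pow 2 u).neg.div_const (4 * t))
  have h2 : HasDerivAt (fun u : ℝ => u / (2 * √t)) (1 / (2 * √t)) u :=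
    (hasDerivAt_id u).div_const _
  have h3 := (h1.exp.const_mul (√t / √π)).add
    (((hasDerivAt_id u).div_const √π).mul ((hasDerivAt_erfInt _).comp u h2))
  refine h3.congr_deriv ?_
  have he : -(u / (2 * √t)) ^ 2 = -u ^ 2 / (4 * t) := by
    rw [div_pow, mul_pow, Real.sq_sqrt ht.le]; ring
  simp only [he, id, Function.comp]
  have hst : t = √t ^ 2 := (Real.sq_sqrt ht.le).symm
  generalize Real.exp (-u ^ 2 / (4 * t)) = e
  rw [hst, Real.sqrt_sq hs.le]
  field_simp
  ring

lemma hasDerivAt_smoothPart_time {r : ℝ} (hr : 0 < r) (u : ℝ) :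
    HasDerivAt (fun r => smoothPart r u)
      ((1 / (2 * √(π * r))) * Real.exp (-u ^ 2 / (4 * r))) r := by
  have hs : 0 < √r := Real.sqrt_pos.2 hr
  have hp : 0 < √π := Real.sqrt_pos.2 Real.pi_pos
  have h0 := Real.hasDerivAt_sqrt hr.ne'
  have h1 : HasDerivAt (fun r : ℝ => -u ^ 2 / (4 * r)) (u ^ 2 / (4 * r ^ 2)) r := by
    have := (hasDerivAt_const r (-u ^ 2)).div ((hasDerivAt_id r).const_mul 4)
      (by simpa using hr.ne')
    refine this.congr_deriv ?_
    simp only [id]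
    field_simp
    ring
  have h2 := (hasDerivAt_const r u).div (h0.const_mul 2) (by positivity)
  have h3 := ((h0.div_const √π).mul h1.exp).add
    (((hasDerivAt_erfInt _).comp r h2).const_mul (u / √π))
  refine h3.congr_deriv ?_
  have he : -(u / (2 * √r)) ^ 2 = -u ^ 2 / (4 * r) := by
    rw [div_pow, mul_pow, Real.sq_sqrt hr.le]; ring
  simp only [Pi.div_apply, he]
  have hst : r = √r ^ 2 := (Real.sq_sqrt hr.le).symm
  rw [Real.sqrt_mul Real.pi_pos.le]
  generalize Real.exp (-u ^ 2 / (4 * r)) = e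
  rw [hst, Real.sqrt_sq hs.le]
  field_simp
  ring

lemma tendsto_smoothPart_zero {u : ℝ} (hu : 0 ≤ u) :
    Filter.Tendsto (fun r => smoothPart r u) (nhdsWithin 0 (Set.Ioi 0)) (nhds (u / 2)) := by
  have hp : 0 < √π := Real.sqrt_pos.2 Real.pi_pos
  have hs : Filter.Tendsto (fun r : ℝ => √r) (nhdsWithin 0 (Set.Ioi 0)) (nhds 0) := by
    simpa using (Real.continuous_sqrt.tendsto 0).mono_left nhdsWithin_le_nhds
  have hs' : Filter.Tendsto (fun r : ℝ => √r) (nhdsWithin 0 (Set.Ioi 0))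
      (nhdsWithin 0 (Set.Ioi 0)) :=
    tendsto_nhdsWithin_iff.2 ⟨hs, by
      filter_upwards [self_mem_nhdsWithin] with r hr using Real.sqrt_pos.2 hr⟩
  have h1 : Filter.Tendsto (fun r : ℝ => √r / √π * Real.exp (-u ^ 2 / (4 * r)))
      (nhdsWithin 0 (Set.Ioi 0)) (nhds 0) := by
    have hb : Filter.Tendsto (fun r : ℝ => √r / √π) (nhdsWithin 0 (Set.Ioi 0)) (nhds 0) := by
      simpa using hs.div_const √π
    refine squeeze_zero' (Filter.Eventually.of_forall fun r => by positivity) ?_ hb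
    filter_upwards [self_mem_nhdsWithin] with r hr
    have hr' : (0:ℝ) < r := hr
    refine mul_le_of_le_one_right (by positivity) (Real.exp_le_one_iff.2 ?_)
    exact div_nonpos_of_nonpos_of_nonneg (neg_nonpos.2 (sq_nonneg u)) (by positivity)
  have h2 : Filter.Tendsto (fun r : ℝ => u / √π * erfInt (u / (2 * √r)))
      (nhdsWithin 0 (Set.Ioi 0)) (nhds (u / 2)) := by
    rcases hu.eq_or_lt with rfl | hu
    · simp
    have hx : Filter.Tendsto (fun r : ℝ => u / (2 * √r)) (nhdsWithin 0 (Set.Ioi 0))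
        Filter.atTop := by
      have := (tendsto_inv_nhdsGT_zero.comp hs').const_mul_atTop (half_pos hu)
      refine this.congr fun r => ?_
      simp only [Function.comp]
      rw [div_mul_eq_div_div, div_eq_mul_inv (u / 2)]
    have := (tendsto_erfInt_atTop.comp hx).const_mul (u / √π)
    have hv : u / √π * (√π / 2) = u / 2 := by field_simp
    rwa [hv] at this
  simpa [smoothPart] using h1.add h2

lemma intervalIntegrable_heatKernel {t : ℝ} (ht : 0 < t) (u : ℝ) :
    IntervalIntegrable (fun r => (1 / (2 * √(π * r))) * Real.exp (-u ^ 2 / (4 * r)))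
      volume 0 t := by
  have hdom : IntervalIntegrable (fun r : ℝ => r ^ (-(1 / 2) : ℝ)) volume 0 t :=
    intervalIntegral.intervalIntegrable_rpow' (by norm_num)
  refine (hdom.const_mul (1 / (2 * √π))).mono_fun ?_ ?_
  · exact (by fun_prop : Measurable _).aestronglyMeasurable
  · rw [Set.uIoc_of_le ht.le]
    filter_upwards [ae_restrict_mem measurableSet_Ioc] with r hr
    have hr' : 0 < r := hr.1
    have heq : 1 / (2 * √(π * r)) = 1 / (2 * √π) * r ^ (-(1 / 2) : ℝ) := by
      rw [Real.sqrt_mul Real.pi_pos.le, Real.rpow_neg hr'.le, ← Real.sqrt_eq_rpow]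
      have := Real.sqrt_pos.2 hr'
      have := Real.sqrt_pos.2 Real.pi_pos
      field_simp
    rw [heq, norm_mul]
    refine mul_le_of_le_one_right (norm_nonneg _) ?_
    rw [Real.norm_of_nonneg (Real.exp_pos _).le]
    refine Real.exp_le_one_iff.2 ?_
    exact div_nonpos_of_nonpos_of_nonneg (neg_nonpos.2 (sq_nonneg u)) (by positivity)

lemma F_eq_smoothPart_sub {t : ℝ} (ht : 0 < t) (u : ℝ) : F t u = smoothPart t u - |u| / 2 := by
  have habs : F t u = F t |u| := by simp only [F, sq_abs]
  rw [habs, ← smoothPart_abs t u]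
  refine intervalIntegral.integral_eq_sub_of_hasDerivAt_of_tendsto ht
    (fun r hr => hasDerivAt_smoothPart_time hr.1 _) (intervalIntegrable_heatKernel ht _)
    (tendsto_smoothPart_zero (abs_nonneg u)) ?_
  exact (hasDerivAt_smoothPart_time ht _).continuousAt.tendsto.mono_left nhdsWithin_le_nhds

lemma abs_sub_le_of_hasDerivAt {f f' : ℝ → ℝ} {C : ℝ} (hf : ∀ x, HasDerivAt f (f' x) x)
    (hC : ∀ x, |f' x| ≤ C) (x y : ℝ) : |f y - f x| ≤ C * |y - x| :=
  convex_univ.norm_image_sub_le_of_norm_hasDerivWithin_le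
    (fun x _ => (hf x).hasDerivWithinAt) (fun x _ => hC x) (Set.mem_univ x) (Set.mem_univ y)

lemma abs_second_difference_le {f f' : ℝ → ℝ} {C : ℝ} (hf : ∀ x, HasDerivAt f (f' x) x)
    (hC : ∀ x y, |f' y - f' x| ≤ C * |y - x|) (x h : ℝ) :
    |f (x + h) - 2 * f x + f (x - h)| ≤ C * h ^ 2 := by
  have hd : ∀ y, HasDerivAt (fun y => f (y + h) - f y) (f' (y + h) - f' y) y := fun y =>
    ((hf (y + h)).comp_add_const y h).sub (hf y)
  have hb : ∀ y, |f' (y + h) - f' y| ≤ C * |h| := fun y => by simpa using hC y (y + h)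
  have := abs_sub_le_of_hasDerivAt hd hb (x - h) x
  simp only [sub_add_cancel, sub_sub_cancel] at this
  calc |f (x + h) - 2 * f x + f (x - h)| = |f (x + h) - f x - (f x - f (x - h))| := by
        congr 1; ring
    _ ≤ C * |h| * |h| := this
    _ = C * h ^ 2 := by rw [mul_assoc, abs_mul_abs_self]; ring

/-- The centred fourth difference of `f` at `x` with step `h`. -/
def fourthDifference (f : ℝ → ℝ) (x h : ℝ) : ℝ :=
  f (x + 2 * h) - 4 * f (x + h) + 6 * f x - 4 * f (x - h) + f (x - 2 * h)

lemma abs_fourthDifference_le {f f' : ℝ → ℝ} {C : ℝ} (hf : ∀ x, HasDerivAt f (f' x) x)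
    (hC : ∀ x y, |f' y - f' x| ≤ C * |y - x|) (x h : ℝ) :
    |fourthDifference f x h| ≤ 4 * C * h ^ 2 := by
  have h1 := abs_le.1 (abs_second_difference_le hf hC (x + h) h)
  have h2 := abs_le.1 (abs_second_difference_le hf hC x h)
  have h3 := abs_le.1 (abs_second_difference_le hf hC (x - h) h)
  rw [add_assoc, ← two_mul, add_sub_cancel_right] at h1
  rw [sub_add_cancel, sub_sub, ← two_mul] at h3
  rw [fourthDifference, abs_le]
  constructor <;> linarith [h1.1, h1.2, h2.1, h2.2, h3.1, h3.2]

lemma abs_fourthDifference_smoothPart_le {t : ℝ} (ht : 0 < t) :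
    ∃ C : ℝ, 0 < C ∧ ∀ x h, |fourthDifference (smoothPart t) x h| ≤ 4 * C * h ^ 2 := by
  have hs : 0 < √t := Real.sqrt_pos.2 ht
  have hp : 0 < √π := Real.sqrt_pos.2 Real.pi_pos
  refine ⟨1 / (2 * √t) / √π, by positivity, fun x h =>
    abs_fourthDifference_le (hasDerivAt_smoothPart ht) ?_ x h⟩
  have hd : ∀ y, HasDerivAt (fun y => erfInt (y / (2 * √t)) / √π)
      (Real.exp (-(y / (2 * √t)) ^ 2) * (1 / (2 * √t)) / √π) y := fun y =>
    ((hasDerivAt_erfInt _).comp y ((hasDerivAt_id y).div_const _)).div_const _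
  refine abs_sub_le_of_hasDerivAt hd fun y => ?_
  rw [abs_of_nonneg (by positivity)]
  gcongr
  refine mul_le_of_le_one_left (by positivity) (Real.exp_le_one_iff.2 ?_)
  exact neg_nonpos.2 (sq_nonneg _)

lemma q_eq_fourthDifference (t : ℝ) (j k k' : ℕ) :
    q t j k k' = 2 ^ j *
      fourthDifference (F t) (2 * ((k : ℝ) - k') * (1 / 2 ^ (j + 1))) (1 / 2 ^ (j + 1)) := by
  simp only [q, fourthDifference, Finset.sum_range_succ, Finset.sum_range_zero, a, c]
  norm_num
  ring_nf

lemma fourthDifference_abs (n : ℤ) {h : ℝ} (hh : 0 < h) :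
    fourthDifference (fun u => |u|) (2 * n * h) h = if n = 0 then -4 * h else 0 := by
  have e : ∀ m : ℝ, |m * h| = |m| * h := fun m => by rw [abs_mul, abs_of_pos hh]
  have h1 : 2 * (n : ℝ) * h + 2 * h = (2 * n + 2) * h := by ring
  have h2 : 2 * (n : ℝ) * h + h = (2 * n + 1) * h := by ring
  have h3 : 2 * (n : ℝ) * h - h = (2 * n - 1) * h := by ring
  have h4 : 2 * (n : ℝ) * h - 2 * h = (2 * n - 2) * h := by ring
  simp only [fourthDifference, h1, h2, h3, h4, e]
  rcases lt_trichotomy n 0 with hn | rfl | hn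
  · have hn' : (n : ℝ) ≤ -1 := by exact_mod_cast Int.le_sub_one_of_lt hn
    rw [if_neg hn.ne, abs_of_nonpos (by linarith), abs_of_nonpos (by linarith),
      abs_of_nonpos (by linarith), abs_of_nonpos (by linarith), abs_of_nonpos (by linarith)]
    ring
  · norm_num
    ring
  · have hn' : (1 : ℝ) ≤ n := by exact_mod_cast hn
    rw [if_neg hn.ne', abs_of_nonneg (by linarith), abs_of_nonneg (by linarith),
      abs_of_nonneg (by linarith), abs_of_nonneg (by linarith), abs_of_nonneg (by linarith)]
    ring

lemma abs_q_sub_ite_le {t : ℝ} (ht : 0 < t) :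
    ∃ C : ℝ, 0 < C ∧ ∀ j k k' : ℕ, |q t j k k' - if k = k' then 1 else 0| ≤ C / 2 ^ j := by
  obtain ⟨C, hC, hb⟩ := abs_fourthDifference_smoothPart_le ht
  refine ⟨C, hC, fun j k k' => ?_⟩
  have hh : (0 : ℝ) < 1 / 2 ^ (j + 1) := by positivity
  have habs := fourthDifference_abs ((k : ℤ) - k') hh
  push_cast at habs
  have hite : (2 : ℝ) ^ j * (-(1 / 2) *
      (if (k : ℤ) - k' = 0 then -4 * (1 / 2 ^ (j + 1) : ℝ) else 0)) =
      if k = k' then 1 else 0 := by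
    by_cases hk : k = k'
    · rw [if_pos hk, if_pos (by omega), pow_succ]
      field_simp
      norm_num
    · rw [if_neg hk, if_neg (by omega)]
      ring
  have hq : (q t j k k' - if k = k' then 1 else 0) = 2 ^ j * fourthDifference (smoothPart t)
      (2 * ((k : ℝ) - k') * (1 / 2 ^ (j + 1))) (1 / 2 ^ (j + 1)) := by
    rw [q_eq_fourthDifference, ← hite, ← habs]
    simp only [fourthDifference, F_eq_smoothPart_sub ht]
    ring
  rw [hq, abs_mul, abs_of_pos (by positivity)]
  calc (2 : ℝ) ^ j * _ ≤ 2 ^ j * (4 * C * (1 / 2 ^ (j + 1)) ^ 2) := by gcongr; exact hb _ _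
    _ = C / 2 ^ j := by
      rw [pow_succ _ j]
      field_simp
      norm_num

lemma sum_sq_corr_le {t C : ℝ} {j : ℕ}
    (hq : ∀ k k' : ℕ, |q t j k k' - if k = k' then 1 else 0| ≤ C / 2 ^ j)
    (hj : 2 * C ≤ 2 ^ j) :
    ∑ k ∈ Finset.Icc 1 (2 ^ j), ∑ k' ∈ Finset.Icc 1 (2 ^ j),
      q t j k k' ^ 2 / (q t j k k * q t j k' k') ≤ (1 + 4 * C ^ 2) * 2 ^ j := by
  have hpow : (0 : ℝ) < 2 ^ j := by positivity
  have hdiag : ∀ k, 1 / 2 ≤ q t j k k := fun k => by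
    have h1 := (abs_le.1 (hq k k)).1
    have h2 : C / 2 ^ j ≤ 1 / 2 := by rw [div_le_iff₀ hpow]; linarith
    rw [if_pos rfl] at h1
    linarith
  have hdd : ∀ k, q t j k k = q t j 0 0 := fun k => by simp [q_eq_fourthDifference]
  have hterm : ∀ k k' : ℕ, q t j k k' ^ 2 / (q t j k k * q t j k' k') ≤
      (if k = k' then 1 else 0) + 4 * (C / 2 ^ j) ^ 2 := fun k k' => by
    have h0 := hdiag 0
    rw [hdd k, hdd k']
    by_cases hk : k = k'
    · subst hk
      rw [hdd k, ← sq, div_self (by positivity), if_pos rfl]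
      exact le_add_of_nonneg_right (by positivity)
    · have h1 := hq k k'
      rw [if_neg hk, sub_zero] at h1
      rw [if_neg hk, zero_add, div_le_iff₀ (by positivity)]
      have h2 : q t j k k' ^ 2 ≤ (C / 2 ^ j) ^ 2 := sq_le_sq' (abs_le.1 h1).1 (abs_le.1 h1).2
      have h3 : 1 ≤ 4 * (q t j 0 0 * q t j 0 0) := by nlinarith
      nlinarith [sq_nonneg (C / 2 ^ j)]
  calc _ ≤ ∑ k ∈ Finset.Icc 1 (2 ^ j), ∑ k' ∈ Finset.Icc 1 (2 ^ j),
        ((if k = k' then 1 else 0) + 4 * (C / 2 ^ j) ^ 2) :=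
        Finset.sum_le_sum fun k _ => Finset.sum_le_sum fun k' _ => hterm k k'
    _ = ∑ k ∈ Finset.Icc 1 (2 ^ j), (1 + 2 ^ j * (4 * (C / 2 ^ j) ^ 2)) := by
        refine Finset.sum_congr rfl fun k hk => ?_
        rw [Finset.sum_add_distrib, Finset.sum_ite_eq, if_pos hk]
        simp
    _ = 2 ^ j + 4 * C ^ 2 := by
        simp only [Finset.sum_const, Nat.card_Icc, add_tsub_cancel_right, nsmul_eq_mul]
        push_cast
        field_simp
    _ ≤ (1 + 4 * C ^ 2) * 2 ^ j := by
        have : (1 : ℝ) ≤ 2 ^ j := one_le_pow₀ (by norm_num)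
        nlinarith [sq_nonneg C]

theorem stmt_11 (t : ℝ) (ht : 0 < t) :
    ∃ K : ℝ, 0 < K ∧ ∀ j : ℕ, 1 ≤ j →
      ∑ k ∈ Finset.Icc 1 (2 ^ j), ∑ k' ∈ Finset.Icc 1 (2 ^ j),
        q t j k k' ^ 2 / (q t j k k * q t j k' k') ≤ K * 2 ^ j := by
  obtain ⟨C, -, hq⟩ := abs_q_sub_ite_le ht
  have hlarge : ∀ᶠ j : ℕ in Filter.atTop, 2 * C ≤ (2 : ℝ) ^ j :=
    (tendsto_pow_atTop_atTop_of_one_lt one_lt_two).eventually_ge_atTop _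
  have hbdd : Filter.IsBoundedUnder (· ≤ ·) Filter.atTop fun j : ℕ =>
      (∑ k ∈ Finset.Icc 1 (2 ^ j), ∑ k' ∈ Finset.Icc 1 (2 ^ j),
        q t j k k' ^ 2 / (q t j k k * q t j k' k')) / 2 ^ j := by
    refine ⟨1 + 4 * C ^ 2, Filter.eventually_map.2 ?_⟩
    filter_upwards [hlarge] with j hj
    exact (div_le_iff₀ (by positivity)).2 (sum_sq_corr_le (hq j) hj)
  obtain ⟨M, hM⟩ := hbdd.bddAbove_range
  refine ⟨max M 1, by positivity, fun j _ => ?_⟩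
  rw [← div_le_iff₀ (by positivity)]
  exact (hM ⟨j, rfl⟩).trans (le_max_left _ _)
end

section
/- There exists a constant C > 0 such that for every x ∈ ℝ and all s, t with 0 ≤ s < t, one has ∫_0^s ∫_ℝ (G(t−r, x−y) − G(s−r, x−y))² dy dr ≤ C (t−s)^{1/2}. -/
open MeasureTheory Real

/-- The Green kernel (heat kernel) of the heat equation `∂ₜu = (1/2)Δu` on `ℝ`. -/
noncomputable def G (t x : ℝ) : ℝ :=
  if 0 < t then (1 / Real.sqrt (2 * Real.pi * t)) * Real.exp (-x ^ 2 / (2 * t)) else 0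

theorem G_mul_G {a b : ℝ} (ha : 0 < a) (hb : 0 < b) (z : ℝ) :
    G a z * G b z = (1 / (√(2 * π * a) * √(2 * π * b))) *
      exp (-((a + b) / (2 * a * b)) * z ^ 2) := by
  have h : -((a + b) / (2 * a * b)) * z ^ 2 = -z ^ 2 / (2 * a) + -z ^ 2 / (2 * b) := by
    field_simp
    ring
  rw [G, G, if_pos ha, if_pos hb, h, exp_add]
  field_simp

theorem integrable_G_mul_G {a b : ℝ} (ha : 0 < a) (hb : 0 < b) :
    Integrable fun z : ℝ => G a z * G b z := by
  simp only [G_mul_G ha hb]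
  exact (integrable_exp_neg_mul_sq (by positivity)).const_mul _

theorem integral_G_mul_G {a b : ℝ} (ha : 0 < a) (hb : 0 < b) :
    ∫ z : ℝ, G a z * G b z = 1 / √(2 * π * (a + b)) := by
  simp only [G_mul_G ha hb]
  rw [integral_const_mul, integral_gaussian, ← sqrt_mul (by positivity), one_div, one_div,
    ← sqrt_inv, ← sqrt_inv, ← sqrt_mul (by positivity)]
  congr 1
  field_simp

theorem integral_sq_G_sub_G {a b : ℝ} (ha : 0 < a) (hb : 0 < b) (x : ℝ) :
    ∫ y : ℝ, (G a (x - y) - G b (x - y)) ^ 2 =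
      (1 / √(2 * π)) * (1 / √(2 * a) + 1 / √(2 * b) - 2 / √(a + b)) := by
  rw [integral_sub_left_eq_self (fun z => (G a z - G b z) ^ 2) volume x]
  have h : ∀ z, (G a z - G b z) ^ 2 = G a z * G a z + G b z * G b z - 2 * (G a z * G b z) :=
    fun z => by ring
  have haa := integrable_G_mul_G ha ha
  have hbb := integrable_G_mul_G hb hb
  have hab := integrable_G_mul_G ha hb
  have hsum : Integrable fun z => G a z * G a z + G b z * G b z := haa.add hbb
  have hmul : ∀ c, √(2 * π * c) = √(2 * π) * √c := sqrt_mul (by positivity)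
  simp only [h]
  rw [integral_sub hsum (hab.const_mul 2), integral_add haa hbb, integral_const_mul,
    integral_G_mul_G ha ha, integral_G_mul_G hb hb, integral_G_mul_G ha hb,
    hmul, hmul, hmul, ← two_mul, ← two_mul]
  ring

theorem sqrt_add_sqrt_le_two_mul_sqrt {a b : ℝ} (ha : 0 ≤ a) (hb : 0 ≤ b) :
    √(2 * a) + √(2 * b) ≤ 2 * √(a + b) := by
  have h1 := sq_sqrt (show 0 ≤ 2 * a by positivity)
  have h2 := sq_sqrt (show 0 ≤ 2 * b by positivity)
  have h3 := sq_sqrt (show 0 ≤ a + b by positivity)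
  refine abs_le_of_sq_le_sq' ?_ (by positivity) |>.2
  nlinarith [sq_nonneg (√(2 * a) - √(2 * b))]

theorem stmt_12 :
    ∃ C : ℝ, 0 < C ∧ ∀ x s t : ℝ, 0 ≤ s → s < t →
      ∫ r in (0:ℝ)..s, ∫ y : ℝ, (G (t - r) (x - y) - G (s - r) (x - y)) ^ 2 ≤
        C * Real.sqrt (t - s) := by
  refine ⟨(1 / √(2 * π)) * 2, by positivity, fun x s t hs hst => ?_⟩
  let F : ℝ → ℝ := fun r =>
    (1 / √(2 * π)) * (2 * √((t - r) + (s - r)) - √(2 * (t - r)) - √(2 * (s - r)))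
  have hcont : ContinuousOn F (Set.Icc 0 s) := by
    unfold F
    fun_prop
  have hderiv : ∀ r ∈ Set.Ioo 0 s, HasDerivAt F
      (∫ y : ℝ, (G (t - r) (x - y) - G (s - r) (x - y)) ^ 2) r := by
    intro r hr
    have hb : 0 < s - r := sub_pos.2 hr.2
    have ha : 0 < t - r := by linarith
    rw [integral_sq_G_sub_G ha hb]
    have d1 : HasDerivAt (fun r => t - r) (-1) r := (hasDerivAt_id r).const_sub t
    have d2 : HasDerivAt (fun r => s - r) (-1) r := (hasDerivAt_id r).const_sub s
    have e1 := (d1.const_mul 2).sqrt (by positivity)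
    have e2 := (d2.const_mul 2).sqrt (by positivity)
    have e3 := ((d1.add d2).sqrt (by simp only [Pi.add_apply]; positivity)).const_mul 2
    refine (((e3.sub e1).sub e2).const_mul (1 / √(2 * π))).congr_deriv ?_
    simp only [Pi.add_apply]
    field_simp
    ring
  have hint : IntervalIntegrable
      (fun r => ∫ y : ℝ, (G (t - r) (x - y) - G (s - r) (x - y)) ^ 2) volume 0 s := by
    refine intervalIntegral.intervalIntegrable_deriv_of_nonneg (g := F) ?_ ?_ ?_
    · rwa [Set.uIcc_of_le hs]
    · simpa [hs] using hderiv
    · exact fun r _ => integral_nonneg fun y => sq_nonneg _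
  rw [intervalIntegral.integral_eq_sub_of_hasDerivAt_of_le hs hcont hderiv hint]
  have h0 : 0 ≤ F 0 := by
    refine mul_nonneg (by positivity) ?_
    have := sqrt_add_sqrt_le_two_mul_sqrt (show 0 ≤ t - 0 by linarith)
      (show 0 ≤ s - 0 by linarith)
    linarith
  have h1 : F s ≤ (1 / √(2 * π)) * 2 * √(t - s) := by
    rw [mul_assoc]
    refine mul_le_mul_of_nonneg_left ?_ (by positivity)
    simp
  linarith
end

section
/- Fix T > 0 and x ∈ ℝ, and for s, t ∈ [0,T] let σ²(s,t) = ∫_0^∞ ∫_ℝ (G(t−τ, x−y) − G(s−τ, x−y))² dy dτ, which equals E[(u(t,x) − u(s,x))²] for the mild solution u of the stochastic heat equation driven by space-time white noise. Then for every real p with 0 ≤ p < 3, the double integral ∫_0^T ∫_0^T [σ²(s,t)]^{−(p+1)/2} ds dt is finite. -/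
open MeasureTheory Real

theorem measurable_G : Measurable (fun q : ℝ × ℝ => G q.1 q.2) := by
  unfold G
  refine Measurable.ite (measurableSet_lt measurable_const measurable_fst) ?_ measurable_const
  fun_prop

theorem G_sq_of_pos {a : ℝ} (ha : 0 < a) (y : ℝ) :
    G a y ^ 2 = (1 / (2 * π * a)) * exp (-(1 / a) * y ^ 2) := by
  have h : 0 ≤ 2 * π * a := by positivity
  rw [G, if_pos ha, mul_pow, div_pow, Real.sq_sqrt h, ← Real.exp_nat_mul, one_pow]
  congr 2
  push_cast
  field_simp

theorem integrable_G_sq (a : ℝ) : Integrable (fun y => G a y ^ 2) := by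
  rcases le_or_gt a 0 with ha | ha
  · simp [G, not_lt.mpr ha]
  · simp only [G_sq_of_pos ha]
    exact (integrable_exp_neg_mul_sq (by positivity)).const_mul _

theorem integral_G_sq (a : ℝ) :
    ∫ y, G a y ^ 2 = (2 * √π)⁻¹ * a ^ (-(1 / 2) : ℝ) * (if 0 < a then 1 else 0) := by
  rcases le_or_gt a 0 with ha | ha
  · simp [G, not_lt.mpr ha]
  · simp only [G_sq_of_pos ha]
    rw [integral_const_mul, integral_gaussian, if_pos ha, Real.rpow_neg ha.le,
      ← Real.sqrt_eq_rpow, div_div_eq_mul_div, div_one, Real.sqrt_mul pi_pos.le]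
    have h1 := Real.mul_self_sqrt ha.le
    have h2 := Real.mul_self_sqrt pi_pos.le
    have h3 : 0 < √a := Real.sqrt_pos.mpr ha
    have h4 : 0 < √π := Real.sqrt_pos.mpr pi_pos
    rw [mul_one, ← mul_inv, one_div, ← div_eq_inv_mul, div_eq_iff (by positivity)]
    field_simp
    nlinarith

theorem integrableOn_integral_G_sq (t : ℝ) :
    IntegrableOn (fun τ => ∫ y, G (t - τ) y ^ 2) (Set.Ioi 0) := by
  rcases le_or_gt t 0 with ht | ht
  · refine (integrableOn_zero (s := Set.Ioi (0 : ℝ))).congr_fun (fun τ hτ => ?_) measurableSet_Ioi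
    have : ¬ 0 < t - τ := by have := Set.mem_Ioi.mp hτ; linarith
    simp [integral_G_sq, this]
  · have h1 : IntervalIntegrable (fun u : ℝ => u ^ (-(1 / 2) : ℝ)) volume t 0 :=
      intervalIntegral.intervalIntegrable_rpow' (by norm_num)
    have h2 := (h1.comp_sub_left t).const_mul (2 * √π)⁻¹
    rw [sub_self, sub_zero, intervalIntegrable_iff_integrableOn_Ioo_of_le ht.le] at h2
    rw [← integrable_indicator_iff measurableSet_Ioo] at h2
    refine h2.integrableOn.congr_fun (fun τ hτ => ?_) measurableSet_Ioi
    by_cases hc : τ < t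
    · have : 0 < t - τ := by linarith
      have hm : τ ∈ Set.Ioo 0 t := ⟨hτ, hc⟩
      simp [integral_G_sq, this, hm]
    · have : ¬ 0 < t - τ := by linarith
      have hm : τ ∉ Set.Ioo 0 t := fun h => hc h.2
      simp [integral_G_sq, this, hm]

theorem integrableOn_integral_G_sub_sq (s t x : ℝ) :
    IntegrableOn (fun τ => ∫ y, (G (t - τ) (x - y) - G (s - τ) (x - y)) ^ 2) (Set.Ioi 0) := by
  have hm : Measurable (fun q : ℝ × ℝ =>
      (G (t - q.1) (x - q.2) - G (s - q.1) (x - q.2)) ^ 2) := by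
    have h (r : ℝ) : Measurable (fun q : ℝ × ℝ => G (r - q.1) (x - q.2)) :=
      measurable_G.comp (f := fun q : ℝ × ℝ => (r - q.1, x - q.2)) (by fun_prop)
    exact ((h t).sub (h s)).pow_const 2
  refine Integrable.mono' (((integrableOn_integral_G_sq t).const_mul 2).add
    ((integrableOn_integral_G_sq s).const_mul 2))
    hm.stronglyMeasurable.integral_prod_right.aestronglyMeasurable
    (Filter.Eventually.of_forall fun τ => ?_)
  rw [Real.norm_of_nonneg (integral_nonneg fun y => sq_nonneg _)]
  have ht := (integrable_G_sq (t - τ)).comp_sub_left x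
  have hs := (integrable_G_sq (s - τ)).comp_sub_left x
  have key : ∫ y, (G (t - τ) (x - y) - G (s - τ) (x - y)) ^ 2 ≤
      ∫ y, (2 * G (t - τ) (x - y) ^ 2 + 2 * G (s - τ) (x - y) ^ 2) := by
    refine integral_mono_of_nonneg (Filter.Eventually.of_forall fun y => sq_nonneg _)
      ((ht.const_mul 2).add (hs.const_mul 2)) (Filter.Eventually.of_forall fun y => ?_)
    dsimp only
    nlinarith [sq_nonneg (G (t - τ) (x - y) + G (s - τ) (x - y))]
  rw [integral_add (ht.const_mul 2) (hs.const_mul 2), integral_const_mul, integral_const_mul,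
    integral_sub_left_eq_self (fun y => G (t - τ) y ^ 2) volume x,
    integral_sub_left_eq_self (fun y => G (s - τ) y ^ 2) volume x] at key
  exact key

theorem sqrt_sub_le_integral_G_sub_sq {s t : ℝ} (hs : 0 ≤ s) (hst : s < t) (x : ℝ) :
    (2 * √π)⁻¹ * (t - s) ^ (1 / 2 : ℝ) ≤ ∫ τ in Set.Ioi (0 : ℝ), ∫ y : ℝ,
      (G (t - τ) (x - y) - G (s - τ) (x - y)) ^ 2 := by
  have hi := integrableOn_integral_G_sub_sq s t x
  have hsub : Set.Ioo s t ⊆ Set.Ioi 0 := fun τ hτ => hs.trans_lt hτ.1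
  have hpos : 0 < t - s := sub_pos.mpr hst
  calc (2 * √π)⁻¹ * (t - s) ^ (1 / 2 : ℝ)
      = ∫ τ in Set.Ioo s t, (2 * √π)⁻¹ * (t - s) ^ (-(1 / 2) : ℝ) := by
        rw [setIntegral_const, Real.volume_real_Ioo_of_le hst.le, smul_eq_mul, mul_left_comm]
        congr 1
        nth_rewrite 2 [← Real.rpow_one (t - s)]
        rw [← Real.rpow_add hpos]
        norm_num
    _ ≤ ∫ τ in Set.Ioo s t, ∫ y : ℝ, (G (t - τ) (x - y) - G (s - τ) (x - y)) ^ 2 := by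
        refine setIntegral_mono_on (integrableOn_const (by simp)) (hi.mono_set hsub)
          measurableSet_Ioo fun τ hτ => ?_
        have h1 : 0 < t - τ := sub_pos.mpr hτ.2
        have h2 : ¬ 0 < s - τ := by linarith [hτ.1]
        have h3 (y : ℝ) : G (s - τ) (x - y) = 0 := by simp only [G, if_neg h2]
        simp only [h3, sub_zero]
        rw [integral_sub_left_eq_self (fun y => G (t - τ) y ^ 2) volume x, integral_G_sq,
          if_pos h1, mul_one]
        exact mul_le_mul_of_nonneg_left
          (Real.rpow_le_rpow_of_nonpos h1 (by linarith [hτ.1]) (by norm_num)) (by positivity)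
    _ ≤ _ := setIntegral_mono_set hi
        (Filter.Eventually.of_forall fun τ => integral_nonneg fun y => sq_nonneg _)
        hsub.eventuallyLE

theorem abs_sub_rpow_le_integral_G_sub_sq {s t : ℝ} (hs : 0 ≤ s) (ht : 0 ≤ t) (x : ℝ) :
    (2 * √π)⁻¹ * |t - s| ^ (1 / 2 : ℝ) ≤ ∫ τ in Set.Ioi (0 : ℝ), ∫ y : ℝ,
      (G (t - τ) (x - y) - G (s - τ) (x - y)) ^ 2 := by
  rcases lt_trichotomy s t with h | rfl | h
  · rw [abs_of_pos (sub_pos.mpr h)]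
    exact sqrt_sub_le_integral_G_sub_sq hs h x
  · simp
  · rw [abs_sub_comm, abs_of_pos (sub_pos.mpr h)]
    refine (sqrt_sub_le_integral_G_sub_sq ht h x).trans_eq ?_
    simp only [sub_sq_comm (G (s - _) _)]

theorem integrableOn_abs_rpow {r : ℝ} (hr : -1 < r) (T : ℝ) :
    IntegrableOn (fun u : ℝ => |u| ^ r) (Set.Icc (-T) T) := by
  rcases lt_or_ge T 0 with hT | hT
  · simp [Set.Icc_eq_empty (show ¬ -T ≤ T by linarith)]
  have h1 : IntervalIntegrable (fun u : ℝ => |u| ^ r) volume 0 T := by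
    refine (intervalIntegral.intervalIntegrable_rpow' hr (a := 0) (b := T)).congr fun u hu => ?_
    rw [Set.uIoc_of_le hT] at hu
    simp only [abs_of_pos hu.1]
  have h2 : IntervalIntegrable (fun u : ℝ => |u| ^ r) volume (-T) 0 := by
    have := ((IntervalIntegrable.iff_comp_neg).mp h1).symm
    simpa using this
  rw [integrableOn_Icc_iff_integrableOn_Ioc,
    ← intervalIntegrable_iff_integrableOn_Ioc_of_le (by linarith)]
  exact h2.trans h1

theorem lintegral_ofReal_abs_rpow_lt_top {c q : ℝ} (hc : 0 < c) (hq : q < 2) (T : ℝ) :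
    ∫⁻ u in Set.Icc (-T) T, ENNReal.ofReal (c * |u| ^ (1 / 2 : ℝ)) ^ (-q) < ⊤ := by
  have hi := (integrableOn_abs_rpow (r := -q / 2) (by linarith) T).const_mul (c ^ (-q))
  refine lt_of_eq_of_lt (lintegral_congr_ae ?_) hi.lintegral_lt_top
  filter_upwards [ae_restrict_of_ae (Measure.ae_ne volume (0 : ℝ))] with u hu
  have hu' : 0 < |u| := abs_pos.mpr hu
  rw [ENNReal.ofReal_rpow_of_pos (by positivity), Real.mul_rpow hc.le (by positivity),
    ← Real.rpow_mul hu'.le]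
  congr 3
  ring

theorem stmt_14 (T : ℝ) (hT : 0 < T) (x : ℝ) (p : ℝ) (hp0 : 0 ≤ p) (hp3 : p < 3) :
    (∫⁻ s in Set.Icc (0:ℝ) T, ∫⁻ t in Set.Icc (0:ℝ) T,
      (ENNReal.ofReal
          (∫ τ in Set.Ioi (0:ℝ), ∫ y : ℝ,
            (G (t - τ) (x - y) - G (s - τ) (x - y)) ^ 2)) ^ (-(p + 1) / 2 : ℝ)) < ⊤ := by
  set q : ℝ := (p + 1) / 2 with hq
  have hexp : -(p + 1) / 2 = -q := by rw [hq]; ring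
  rw [hexp]
  set F : ℝ → ENNReal :=
    fun u => ENNReal.ofReal ((2 * √π)⁻¹ * |u| ^ (1 / 2 : ℝ)) ^ (-q) with hF
  have hFtop : ∫⁻ u in Set.Icc (-T) T, F u < ⊤ :=
    lintegral_ofReal_abs_rpow_lt_top (by positivity) (by linarith) T
  refine lt_of_le_of_lt (b := ∫⁻ s in Set.Icc (0 : ℝ) T, ∫⁻ u in Set.Icc (-T) T, F u) ?_ ?_
  · refine setLIntegral_mono measurable_const fun s hs => ?_
    calc _ ≤ ∫⁻ t in Set.Icc (0 : ℝ) T, F (t - s) := by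
          refine setLIntegral_mono' measurableSet_Icc fun t ht => ?_
          rw [hF]
          simp only [ENNReal.rpow_neg]
          rw [ENNReal.inv_le_inv]
          exact ENNReal.rpow_le_rpow (ENNReal.ofReal_le_ofReal
            (abs_sub_rpow_le_integral_G_sub_sq hs.1 ht.1 x)) (by rw [hq]; linarith)
      _ ≤ ∫⁻ t, (Set.Icc (-T) T).indicator F (t - s) := by
          rw [← lintegral_indicator measurableSet_Icc]
          refine lintegral_mono (Set.indicator_le fun t ht => ?_)
          rw [Set.indicator_of_mem]
          exact ⟨by linarith [ht.1, hs.2], by linarith [ht.2, hs.1]⟩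
      _ = ∫⁻ u in Set.Icc (-T) T, F u := by
          rw [lintegral_sub_right_eq_self, lintegral_indicator measurableSet_Icc]
  · rw [setLIntegral_const]
    exact ENNReal.mul_lt_top hFtop (by simp)
end
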